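/- arXiv:math/0508289 — 4 statements merged into one kernel-verified Lean document; each statement's English description precedes it below -/
import Mathlib

section
/- Suppose the polynomial p factors as p = r·p̃ in 𝔷[u], where p̃(u) = −u^{ñ+1} + Ã_0 u^{ñ} + … + Ã_{ñ} with Ã_i ∈ 𝔷 and ñ ≥ 1, and r ∈ 𝔷[u] is monic of degree n − ñ. Let ξ, ζ̃ ∈ 𝔷 satisfy ξ ζ̃ = p̃(0), and put ζ := r(0) ζ̃ (so that ξζ = p(0)). Then the natural projection homomorphism θ: H_p(x) → H_{p̃}(x) maps the principal baxterized element K_p(ξ,ζ,x) to r(ξx) · K_{p̃}(ξ,ζ̃,x). -/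
noncomputable section
namespace Baxterization
open scoped TensorProduct

/-! ## The affine Hecke algebra of rank one -/

variable (k : Type) [Field k]
variable (z : Type) [CommRing z] [Algebra k z]

/-- the two generators R and K -/
inductive G : Type | R | K

/-- The defining relations of the affine Hecke algebra of rank one:
the Hecke condition `R² = ωR + 1` and the reflection equation `RKRK = KRKR`. -/
inductive HRel (ω : z) : FreeAlgebra z G → FreeAlgebra z G → Prop
  | hecke : HRel ω (FreeAlgebra.ι z G.R * FreeAlgebra.ι z G.R)
      (ω • FreeAlgebra.ι z G.R + 1)
  | re : HRel ω (FreeAlgebra.ι z G.R * FreeAlgebra.ι z G.K * FreeAlgebra.ι z G.R *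
        FreeAlgebra.ι z G.K)
      (FreeAlgebra.ι z G.K * FreeAlgebra.ι z G.R * FreeAlgebra.ι z G.K * FreeAlgebra.ι z G.R)

/-- The affine Hecke algebra of rank one over 𝔷, with parameter ω: the quotient of the
free algebra 𝔷⟨R,K⟩ by the ideal of relations `R² = ωR + 1` and `RKRK = KRKR`. -/
def H (ω : z) : Type := RingQuot (HRel z ω)

variable (ω : z)

instance : Ring (H z ω) := inferInstanceAs (Ring (RingQuot (HRel z ω)))
instance : Algebra z (H z ω) := inferInstanceAs (Algebra z (RingQuot (HRel z ω)))
instance : Algebra k (H z ω) := inferInstanceAs (Algebra k (RingQuot (HRel z ω)))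
instance : IsScalarTower k z (H z ω) :=
  inferInstanceAs (IsScalarTower k z (RingQuot (HRel z ω)))

/-- the generator R of the affine Hecke algebra -/
def Rg : H z ω := RingQuot.mkAlgHom z (HRel z ω) (FreeAlgebra.ι z G.R)
/-- the generator K of the affine Hecke algebra -/
def Kg : H z ω := RingQuot.mkAlgHom z (HRel z ω) (FreeAlgebra.ι z G.K)
/-- Y = RKR -/
def Yg : H z ω := Rg z ω * Kg z ω * Rg z ω

/-- the elements e_{i;j} = KⁱRKʲ - KʲRKⁱ of the affine Hecke algebra -/
def eH (i j : ℕ) : H z ω :=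
  Kg z ω ^ i * Rg z ω * Kg z ω ^ j - Kg z ω ^ j * Rg z ω * Kg z ω ^ i

/-! ## The cyclotomic Hecke algebra -/

/-- the element p(K) of H, where p(u) = -u^(n+1) + A₀ uⁿ + A₁ u^(n-1) + ⋯ + Aₙ -/
def pKelt (n : ℕ) (A : ℕ → z) : H z ω :=
  - (Kg z ω) ^ (n + 1) + ∑ i ∈ Finset.range (n + 1), A i • (Kg z ω) ^ (n - i)

/-- relation generating the two-sided ideal (p(K)) of H -/
inductive CRel (n : ℕ) (A : ℕ → z) : H z ω → H z ω → Prop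
  | mk : CRel n A (pKelt z ω n A) 0

/-- The cyclotomic Hecke algebra H_p: the quotient of the affine Hecke algebra H by the
two-sided ideal generated by p(K), where p(u) = -u^(n+1) + A₀ uⁿ + ⋯ + Aₙ. -/
def Hp (n : ℕ) (A : ℕ → z) : Type := RingQuot (CRel z ω n A)

instance (n : ℕ) (A : ℕ → z) : Ring (Hp z ω n A) :=
  inferInstanceAs (Ring (RingQuot (CRel z ω n A)))
instance (n : ℕ) (A : ℕ → z) : Algebra z (Hp z ω n A) :=
  inferInstanceAs (Algebra z (RingQuot (CRel z ω n A)))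
instance (n : ℕ) (A : ℕ → z) : Algebra k (Hp z ω n A) :=
  inferInstanceAs (Algebra k (RingQuot (CRel z ω n A)))
instance (n : ℕ) (A : ℕ → z) : IsScalarTower k z (Hp z ω n A) :=
  inferInstanceAs (IsScalarTower k z (RingQuot (CRel z ω n A)))

/-- the image of R in the cyclotomic Hecke algebra -/
def Rp (n : ℕ) (A : ℕ → z) : Hp z ω n A :=
  RingQuot.mkAlgHom z (CRel z ω n A) (Rg z ω)
/-- the image of K in the cyclotomic Hecke algebra -/
def Kp (n : ℕ) (A : ℕ → z) : Hp z ω n A :=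
  RingQuot.mkAlgHom z (CRel z ω n A) (Kg z ω)
/-- Y = RKR in the cyclotomic Hecke algebra -/
def Yp (n : ℕ) (A : ℕ → z) : Hp z ω n A := Rp z ω n A * Kp z ω n A * Rp z ω n A

/-- the elements e_{i;j} = KⁱRKʲ - KʲRKⁱ of the cyclotomic Hecke algebra -/
def eHp (n : ℕ) (A : ℕ → z) (i j : ℕ) : Hp z ω n A :=
  Kp z ω n A ^ i * Rp z ω n A * Kp z ω n A ^ j -
    Kp z ω n A ^ j * Rp z ω n A * Kp z ω n A ^ i

/-- the element K̃ = Kⁿ - A₀K^(n-1) - ⋯ - A_(n-1) of the cyclotomic Hecke algebra -/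
def Ktil (n : ℕ) (A : ℕ → z) : Hp z ω n A :=
  Kp z ω n A ^ n - ∑ i ∈ Finset.range n, A i • Kp z ω n A ^ (n - 1 - i)

/-! ## Rational functions in one and two variables, and the spectral reflection equation -/

/-- polynomials in two variables x, y over the base field -/
abbrev P2 := MvPolynomial (Fin 2) k
/-- the field k(x,y) of rational functions in the two variables x, y -/
abbrev F2 := FractionRing (P2 k)

/-- auxiliary: the embedding k[X] → k(x,y), X ↦ i-th variable -/
def embP (i : Fin 2) : Polynomial k →ₐ[k] F2 k :=
  (IsScalarTower.toAlgHom k (P2 k) (F2 k)).comp (Polynomial.aeval (MvPolynomial.X i))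

lemma embP_injective (i : Fin 2) : Function.Injective (embP k i) := by
  have h : ((MvPolynomial.aeval (R := k) (fun j => if j = i then Polynomial.X else 0)).comp
      (Polynomial.aeval (R := k) (MvPolynomial.X i : P2 k))) = AlgHom.id k (Polynomial k) := by
    apply Polynomial.algHom_ext; simp
  have hinj : Function.Injective (Polynomial.aeval (R := k) (MvPolynomial.X i : P2 k)) := by
    intro a b hab
    have h2 := congrArg (MvPolynomial.aeval (R := k)
      (fun j : Fin 2 => if j = i then (Polynomial.X : Polynomial k) else 0)) hab
    have ha := congrFun (congrArg (fun (f : Polynomial k →ₐ[k] Polynomial k) =>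
      (f : Polynomial k → Polynomial k)) h) a
    have hb := congrFun (congrArg (fun (f : Polynomial k →ₐ[k] Polynomial k) =>
      (f : Polynomial k → Polynomial k)) h) b
    simp only [AlgHom.coe_comp, Function.comp_apply, AlgHom.coe_id, id_eq] at ha hb
    rw [← ha, ← hb]; exact h2
  exact (IsFractionRing.injective (P2 k) (F2 k)).comp hinj

/-- the embedding k(x) → k(x,y) sending the variable to the i-th of the two variables -/
def emb (i : Fin 2) : RatFunc k →ₐ[k] F2 k :=
  RatFunc.liftAlgHom (embP k i)
    (nonZeroDivisors_le_comap_nonZeroDivisors_of_injective _ (embP_injective k i))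

/-- the first spectral variable x, as an element of k(x,y) -/
def xvar : F2 k := algebraMap (P2 k) (F2 k) (MvPolynomial.X 0)
/-- the second spectral variable y, as an element of k(x,y) -/
def yvar : F2 k := algebraMap (P2 k) (F2 k) (MvPolynomial.X 1)

variable {B : Type} [Ring B] [Algebra k B]

/-- substitution of the spectral variable x by the i-th of the two variables x, y:
the map B(x) → B(x,y) induced by `emb i`. -/
def iota (i : Fin 2) : RatFunc k ⊗[k] B →ₐ[k] F2 k ⊗[k] B :=
  Algebra.TensorProduct.map (emb k i) (AlgHom.id k B)

/-- the baxterized R-matrix `R(t) = R - t⁻¹ R⁻¹` (note `R⁻¹ = R - ω` by the Hecke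
condition), as an element of B(x,y). -/
def RxElt (ωk : k) (Relt : B) (t : F2 k) : F2 k ⊗[k] B :=
  (1 : F2 k) ⊗ₜ[k] Relt - t⁻¹ • ((1 : F2 k) ⊗ₜ[k] (Relt - algebraMap k B ωk))

/-- `c`, viewed as an element `K(x)` of `B(x)`, satisfies the reflection equation with
spectral parameter:  `R(x/y) K(x) R(xy) K(y) = K(y) R(xy) K(x) R(x/y)` in B(x,y). -/
def IsSol (ωk : k) (Relt : B) (c : RatFunc k ⊗[k] B) : Prop :=
  RxElt k ωk Relt (xvar k / yvar k) * iota k 0 c * RxElt k ωk Relt (xvar k * yvar k) *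
      iota k 1 c =
    iota k 1 c * RxElt k ωk Relt (xvar k * yvar k) * iota k 0 c *
      RxElt k ωk Relt (xvar k / yvar k)

variable [Algebra z B]

/-- `c` lies in `𝔷(x)·1`, i.e. `c` is a scalar element of `B(x)`
(an element with trivial B-component). -/
def IsScalarElt (c : RatFunc k ⊗[k] B) : Prop :=
  c ∈ Submodule.span (RatFunc k)
    (Set.range fun a : z => (1 : RatFunc k) ⊗ₜ[k] (algebraMap z B a))

/-- the functions φ_i(ξ,x) (φ₀ = 1, φ_{i+1} = φ_i·ξx - A_i),
viewed as (central, scalar) elements of B(x). -/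
def phiT (ξ : z) (A : ℕ → z) : ℕ → RatFunc k ⊗[k] B
  | 0 => 1
  | (i + 1) => phiT ξ A i * ((RatFunc.X : RatFunc k) ⊗ₜ[k] algebraMap z B ξ)
      - (1 : RatFunc k) ⊗ₜ[k] (algebraMap z B (A i))

/-- the principal baxterized element
`K_p(ξ,ζ,x) = ∑_{i=0}^{n-1} φ_i(ξ,x) K^{n-i} + (ζ - x⁻¹ φ_n(ξ,x))/(x - x⁻¹)`,
as an element of 𝒦_p(x) ⊆ H_p(x). -/
def KxMain (n : ℕ) (A : ℕ → z) (ξ ζ : z) : RatFunc k ⊗[k] Hp z ω n A :=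
  (∑ i ∈ Finset.range n,
      phiT k z (B := Hp z ω n A) ξ A i * ((1 : RatFunc k) ⊗ₜ[k] (Kp z ω n A) ^ (n - i))) +
    ((RatFunc.X - RatFunc.X⁻¹)⁻¹ : RatFunc k) •
      ((1 : RatFunc k) ⊗ₜ[k] algebraMap z (Hp z ω n A) ζ -
        (RatFunc.X⁻¹ : RatFunc k) • phiT k z (B := Hp z ω n A) ξ A n)

/-- the scalar function ψ(ξ,ζ,x) = (-ξⁿx^{n+1} + ∑_{i=0}^{n-1} A_i ξ^{n-1-i} x^{n-i} + ζ)/(x-x⁻¹),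
viewed as a (scalar) element of H_p(x). -/
def psiT (n : ℕ) (A : ℕ → z) (ξ ζ : z) : RatFunc k ⊗[k] Hp z ω n A :=
  ((RatFunc.X - RatFunc.X⁻¹)⁻¹ : RatFunc k) •
    (((∑ i ∈ Finset.range n,
        (RatFunc.X ^ (n - i) : RatFunc k) ⊗ₜ[k]
          algebraMap z (Hp z ω n A) (A i * ξ ^ (n - 1 - i))) +
      (1 : RatFunc k) ⊗ₜ[k] algebraMap z (Hp z ω n A) ζ) -
      ((RatFunc.X ^ (n + 1) : RatFunc k) ⊗ₜ[k] algebraMap z (Hp z ω n A) (ξ ^ n)))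

/-- An element of 𝒦_p(x) is a *principal* solution if n = 1, or if n > 1 and the
coefficient of K^(n-1) in its expansion over the basis {1, K, …, K^(n-1), K̃} of 𝒦_p,
where K̃ = Kⁿ - A₀K^(n-1) - ⋯ - A_(n-1), is non-zero. -/
def IsPrincipal (n : ℕ) (A : ℕ → z) (c : RatFunc k ⊗[k] Hp z ω n A) : Prop :=
  n = 1 ∨ (1 < n ∧ ∃ f : ℕ → RatFunc k ⊗[k] Hp z ω n A,
    (∀ i, IsScalarElt k z (B := Hp z ω n A) (f i)) ∧
    c = (∑ i ∈ Finset.range n, f i * ((1 : RatFunc k) ⊗ₜ[k] (Kp z ω n A) ^ i)) +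
        f n * ((1 : RatFunc k) ⊗ₜ[k] Ktil z ω n A) ∧
    f (n - 1) ≠ 0)

/-! ## Commutative auxiliaries: the polynomial p, the functions φ and the coefficients A⁽ᵐ⁾ -/

/-- the polynomial p(u) = -u^(n+1) + A₀ uⁿ + ⋯ + Aₙ -/
def pPoly (n : ℕ) (A : ℕ → z) : Polynomial z :=
  - Polynomial.X ^ (n + 1) +
    ∑ i ∈ Finset.range (n + 1), Polynomial.C (A i) * Polynomial.X ^ (n - i)

/-- the polynomials φ_i(ξ,x) ∈ 𝔷[x]: φ₀ = 1, φ_{i+1} = φ_i·ξx - A_i -/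
def phiP (A : ℕ → z) (ξ : z) : ℕ → Polynomial z
  | 0 => 1
  | (i + 1) => phiP A ξ i * (Polynomial.C ξ * Polynomial.X) - Polynomial.C (A i)

/-- the monic polynomial u^(n+1) - A₀uⁿ - ⋯ - Aₙ (i.e. -p(u)) -/
def qPoly (n : ℕ) (A : ℕ → z) : Polynomial z :=
  Polynomial.X ^ (n + 1) -
    ∑ i ∈ Finset.range (n + 1), Polynomial.C (A i) * Polynomial.X ^ (n - i)

/-- the coefficients A⁽ᵐ⁾_i ∈ 𝔷 defined by uᵐ ≡ ∑_{i=0}^n A⁽ᵐ⁾_i u^{n-i}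
modulo the monic polynomial u^(n+1) - A₀uⁿ - ⋯ - Aₙ -/
def Am (n : ℕ) (A : ℕ → z) (m i : ℕ) : z :=
  ((Polynomial.X : Polynomial z) ^ m %ₘ qPoly z n A).coeff (n - i)

/-- polynomials in two variables over 𝔷 -/
abbrev ZP2 := MvPolynomial (Fin 2) z

/-- the embedding 𝔷[u] → 𝔷[x,y] sending u to the i-th variable -/
def evP (i : Fin 2) : Polynomial z →ₐ[z] ZP2 z := Polynomial.aeval (MvPolynomial.X i)

/-- The subalgebra 𝒦_p(x) of H_p(x): rational functions of x with values in the
subalgebra 𝒦_p ⊆ H_p generated by K (over 𝔷). -/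
def KpX (n : ℕ) (A : ℕ → z) : Subalgebra (RatFunc k) (RatFunc k ⊗[k] Hp z ω n A) :=
  Algebra.adjoin (RatFunc k)
    ({(1 : RatFunc k) ⊗ₜ[k] Kp z ω n A} ∪
      Set.range (fun a : z => (1 : RatFunc k) ⊗ₜ[k] algebraMap z (Hp z ω n A) a))


open Polynomial in
lemma sum_phiP_mul_sub (A : ℕ → z) (n : ℕ) :
    (∑ i ∈ Finset.range (n + 1), C (phiP z A 1 i) * (X : z[X][X]) ^ (n - i)) * (X - C X) =
      C (pPoly z n A) - (pPoly z n A).map C := by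
  have pPoly_succ (n : ℕ) : pPoly z (n + 1) A = pPoly z n A * X + C (A (n + 1)) := by
    rw [pPoly, pPoly, Finset.sum_range_succ, add_mul, Finset.sum_mul]
    have : ∀ i ∈ Finset.range (n + 1), C (A i) * X ^ (n + 1 - i) = C (A i) * X ^ (n - i) * X := by
      intro i hi
      rw [Nat.succ_sub (Nat.lt_succ_iff.mp (Finset.mem_range.mp hi)), pow_succ, mul_assoc]
    rw [Finset.sum_congr rfl this]
    simp only [Nat.sub_self, pow_zero]
    ring
  have phiP_succ_eq (n : ℕ) : phiP z A 1 (n + 1) = -pPoly z n A := by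
    induction n with
    | zero => simp [phiP, pPoly]; ring
    | succ n ih => rw [phiP, ih, pPoly_succ]; simp; ring
  induction n with
  | zero => simp [phiP, pPoly]; ring
  | succ n ih =>
    rw [Finset.sum_range_succ]
    have : ∀ i ∈ Finset.range (n + 1), C (phiP z A 1 i) * (X : z[X][X]) ^ (n + 1 - i) =
        C (phiP z A 1 i) * X ^ (n - i) * X := by
      intro i hi
      rw [Nat.succ_sub (Nat.lt_succ_iff.mp (Finset.mem_range.mp hi)), pow_succ, mul_assoc]
    rw [Finset.sum_congr rfl this, ← Finset.sum_mul, add_mul, mul_right_comm, ih, phiP_succ_eq,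
      pPoly_succ]
    simp
    ring

open Polynomial in
lemma sum_phiP_of_factor (A At : ℕ → z) (n nt : ℕ) (r : z[X])
    (hfac : pPoly z n A = r * pPoly z nt At) :
    ∃ d : z[X][X], C r - r.map C = d * (X - C X) ∧
      ∑ i ∈ Finset.range (n + 1), C (phiP z A 1 i) * (X : z[X][X]) ^ (n - i) =
        C r * (∑ i ∈ Finset.range (nt + 1), C (phiP z At 1 i) * (X : z[X][X]) ^ (nt - i)) +
          d * (pPoly z nt At).map C := by
  obtain ⟨d, hd⟩ : (X - C X : z[X][X]) ∣ C r - r.map C := by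
    rw [dvd_iff_isRoot]
    simp [eval_map]
  refine ⟨d, by rw [hd, mul_comm], (monic_X_sub_C (X : z[X])).isRegular.right ?_⟩
  simp only [add_mul, mul_assoc]
  rw [sum_phiP_mul_sub, sum_phiP_mul_sub, hfac]
  simp only [Polynomial.map_mul, C_mul]
  linear_combination (pPoly z nt At).map C * hd

open Polynomial in
lemma phiP_of_factor {A At : ℕ → z} {n nt : ℕ} {r : z[X]} {d : z[X][X]}
    (h : ∑ i ∈ Finset.range (n + 1), C (phiP z A 1 i) * (X : z[X][X]) ^ (n - i) =
        C r * (∑ i ∈ Finset.range (nt + 1), C (phiP z At 1 i) * (X : z[X][X]) ^ (nt - i)) +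
          d * (pPoly z nt At).map C) :
    phiP z A 1 n = r * phiP z At 1 nt + d.eval 0 * C (At nt) := by
  have eval_sum (A : ℕ → z) (n : ℕ) :
      eval 0 (∑ i ∈ Finset.range (n + 1), C (phiP z A 1 i) * (X : z[X][X]) ^ (n - i)) =
        phiP z A 1 n := by
    rw [Finset.sum_range_succ, eval_add, eval_finsetSum, Finset.sum_eq_zero]
    · simp
    · intro i hi
      simp [Nat.sub_ne_zero_of_lt (Finset.mem_range.mp hi)]
  have eval_p : eval 0 ((pPoly z nt At).map C) = C (At nt) := by
    rw [eval_map, pPoly, Finset.sum_range_succ, eval₂_add, eval₂_add, eval₂_finsetSum,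
      Finset.sum_eq_zero]
    · simp
    · intro i hi
      simp [Nat.sub_ne_zero_of_lt (Finset.mem_range.mp hi)]
  have := congrArg (eval 0) h
  rwa [eval_add, eval_mul, eval_mul, eval_sum, eval_sum, eval_p, eval_C] at this

open Polynomial in
lemma eval₂_commute_of_central {T : Type*} [Ring T] (ι : z →+* T)
    (hι : ∀ a t, Commute (ι a) t) {y : T} (hy : ∀ t, Commute y t)
    (p : z[X]) (t : T) : Commute (p.eval₂ ι y) t := by
  induction p using Polynomial.induction_on' with
  | add p q hp hq => rw [eval₂_add]; exact hp.add_left hq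
  | monomial n a => rw [eval₂_monomial]; exact (hι a t).mul_left ((hy t).pow_left n)

open Polynomial in
lemma sum_horner_of_factor {T : Type*} [Ring T] (ι : z →+* T)
    (hι : ∀ a t, Commute (ι a) t) {y : T} (hy : ∀ t, Commute y t)
    {A At : ℕ → z} {n nt : ℕ} {r : z[X]}
    (hfac : pPoly z n A = r * pPoly z nt At) {K : T} (hK : (pPoly z nt At).eval₂ ι K = 0) {x : T}
    (hx : ∀ t, Commute x t) {xi zetat : z} (hxi : xi * zetat = At nt) (hyx : y = x * ι xi)
    {φ φt : ℕ → T} (hφ0 : φ 0 = 1) (hφ : ∀ i, φ (i + 1) = φ i * y - ι (A i))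
    (hφt0 : φt 0 = 1) (hφt : ∀ i, φt (i + 1) = φt i * y - ι (At i)) :
    ∑ i ∈ Finset.range (n + 1), φ i * K ^ (n - i) =
        r.eval₂ ι y * ∑ i ∈ Finset.range (nt + 1), φt i * K ^ (nt - i) ∧
      ι (r.coeff 0 * zetat) - x * φ n = r.eval₂ ι y * (ι zetat - x * φt nt) := by
  obtain ⟨d, hd, hsum⟩ := sum_phiP_of_factor z A At n nt r hfac
  let ev : z[X] →+* T := eval₂RingHom' ι y fun a => hι a y
  have hev (p : z[X]) : ev p = p.eval₂ ι y := rfl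
  have hevc (p : z[X]) (t : T) : Commute (ev p) t := eval₂_commute_of_central z ι hι hy p t
  let Φ : z[X][X] →+* T := eval₂RingHom' ev K fun p => hevc p K
  have hΦC (p : z[X]) : Φ (C p) = ev p := eval₂_C _ _
  have hΦX : Φ X = K := eval₂_X _ _
  have hΦmap (p : z[X]) : Φ (p.map C) = p.eval₂ ι K := by
    induction p using Polynomial.induction_on' with
    | add p q hp hq => rw [Polynomial.map_add, map_add, eval₂_add, hp, hq]
    | monomial n a =>
      rw [map_monomial, ← C_mul_X_pow_eq_monomial, map_mul, map_pow, hΦC, hΦX, hev, eval₂_C,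
        eval₂_monomial]
  have horner {A : ℕ → z} {φ : ℕ → T} (hφ0 : φ 0 = 1)
      (hφ : ∀ i, φ (i + 1) = φ i * y - ι (A i)) (i : ℕ) : ev (phiP z A 1 i) = φ i := by
    induction i with
    | zero => simp [phiP, hφ0]
    | succ i ih =>
      rw [phiP, map_sub, map_mul, map_mul, ih, hφ, map_one, map_one, one_mul, hev, hev, eval₂_X,
        eval₂_C]
  constructor
  · have := congrArg Φ hsum
    simpa only [map_sum, map_add, map_mul, map_pow, hΦC, hΦX, hΦmap, hK, mul_zero, add_zero,
      horner hφ0 hφ, horner hφt0 hφt, hev r] using this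
  · have h1 := congrArg ev (phiP_of_factor z hsum)
    rw [map_add, map_mul, map_mul, horner hφ0 hφ, horner hφt0 hφt, hev (C _), eval₂_C, ← hxi,
      map_mul] at h1
    have h2 := congrArg (fun f => ev (f.eval 0)) hd
    simp only [eval_sub, eval_C, eval_mul, eval_X, eval_map, zero_sub, mul_neg, map_sub, map_neg,
      map_mul] at h2
    have h0 : ev (eval₂ C 0 r) = ι (r.coeff 0) := by
      rw [← coeff_zero_eq_eval_zero (r.map C) |>.trans (eval_map _ _), coeff_map, hev, eval₂_C]
    rw [h0, hev X, eval₂_X, hyx] at h2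
    rw [h1, map_mul, ← hev r]
    have h3 : x * (ev (eval 0 d) * (ι xi * ι zetat)) = ι (r.coeff 0) * ι zetat - ev r * ι zetat := by
      rw [← sub_mul, ← neg_sub (ev r), h2, neg_neg, ← mul_assoc, ← mul_assoc, ← mul_assoc,
        (hevc _ _).eq]
    rw [mul_add, h3, mul_sub, ← mul_assoc x, (hx (ev r)).eq, mul_assoc]
    abel

lemma eval₂_pPoly_Kp (n : ℕ) (A : ℕ → z) :
    (pPoly z n A).eval₂ (algebraMap z (Hp z ω n A)) (Kp z ω n A) = 0 := by
  have h : RingQuot.mkAlgHom z (CRel z ω n A) (pKelt z ω n A) = 0 := by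
    rw [RingQuot.mkAlgHom_rel z (CRel.mk (z := z) (ω := ω) (n := n) (A := A)), map_zero]
  refine Eq.trans ?_ h
  rw [← Polynomial.aeval_def, pPoly, pKelt]
  simp only [map_add, map_neg, map_pow, map_sum, map_mul, Polynomial.aeval_X,
    Polynomial.aeval_C, Algebra.smul_def, AlgHom.commutes]
  rfl

lemma KxMain_eq (n : ℕ) (A : ℕ → z) (ξ ζ : z) :
    KxMain k z ω n A ξ ζ =
      (∑ i ∈ Finset.range (n + 1),
        phiT k z (B := Hp z ω n A) ξ A i * ((1 : RatFunc k) ⊗ₜ[k] Kp z ω n A ^ (n - i))) +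
      ((RatFunc.X - RatFunc.X⁻¹)⁻¹ : RatFunc k) •
        ((1 : RatFunc k) ⊗ₜ[k] algebraMap z (Hp z ω n A) ζ -
          (RatFunc.X : RatFunc k) • phiT k z (B := Hp z ω n A) ξ A n) := by
  have hX : (RatFunc.X - RatFunc.X⁻¹ : RatFunc k) ≠ 0 := by
    intro h
    have := congrArg RatFunc.intDegree (sub_eq_zero.mp h)
    rw [RatFunc.intDegree_inv, RatFunc.intDegree_X] at this
    omega
  rw [KxMain, Finset.sum_range_succ, add_assoc, Nat.sub_self, pow_zero,
    mul_one]
  congr 1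
  nth_rw 2 [← one_smul (RatFunc k) (phiT k z (B := Hp z ω n A) ξ A n)]
  rw [← inv_mul_cancel₀ hX]
  simp only [mul_smul, sub_smul, smul_sub]
  abel

/-- Suppose p = r·p̃ in 𝔷[u] with p̃(u) = −u^{ñ+1} + Ã₀u^{ñ} + ⋯ + Ã_{ñ},
ñ ≥ 1, and r monic of degree n − ñ. Let ξζ̃ = p̃(0) and ζ = r(0)ζ̃. Then the natural
projection homomorphism θ : H_p(x) → H_{p̃}(x) maps K_p(ξ,ζ,x) to r(ξx)·K_{p̃}(ξ,ζ̃,x). -/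
theorem projection_of_principal_solution [CharZero k]
    (q : k) (hq0 : q ≠ 0) (hq1 : q ≠ 1) (hq1' : q ≠ -1)
    (hω : ω = algebraMap k z (q - q⁻¹))
    (n nt : ℕ) (hnt : 1 ≤ nt) (hn : nt ≤ n) (A At : ℕ → z)
    (r : Polynomial z) (hr : r.Monic) (hdeg : r.natDegree = n - nt)
    (hfac : pPoly z n A = r * pPoly z nt At)
    (xi zetat : z) (hxi : xi * zetat = At nt) :
    ∀ θ : Hp z ω n A →ₐ[k] Hp z ω nt At,
      θ (Rp z ω n A) = Rp z ω nt At →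
      θ (Kp z ω n A) = Kp z ω nt At →
      (∀ a : z, θ (algebraMap z (Hp z ω n A) a) = algebraMap z (Hp z ω nt At) a) →
      Algebra.TensorProduct.map (AlgHom.id k (RatFunc k)) θ
          (KxMain k z ω n A xi (r.coeff 0 * zetat)) =
        (∑ jj ∈ Finset.range (r.natDegree + 1),
            ((RatFunc.X : RatFunc k) ^ jj) ⊗ₜ[k]
              algebraMap z (Hp z ω nt At) (r.coeff jj * xi ^ jj)) *
          KxMain k z ω nt At xi zetat := by
  intro θ _ hK hz
  set Θ := Algebra.TensorProduct.map (AlgHom.id k (RatFunc k)) θ with hΘ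
  have hphi (i : ℕ) : Θ (phiT k z xi A i) = phiT k z xi A i := by
    induction i with
    | zero => exact map_one Θ
    | succ i ih =>
      rw [phiT, map_sub, map_mul, ih]
      simp [phiT, hΘ, hz]
  have hsmul (c : RatFunc k) (t : RatFunc k ⊗[k] Hp z ω n A) : Θ (c • t) = c • Θ t := by
    rw [Algebra.smul_def, Algebra.smul_def, map_mul]
    simp [hΘ]
  let ι : z →+* RatFunc k ⊗[k] Hp z ω nt At :=
    (Algebra.TensorProduct.includeRight (R := k) (A := RatFunc k)).toRingHom.comp
      (algebraMap z (Hp z ω nt At))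
  have hιa (a : z) : ι a = (1 : RatFunc k) ⊗ₜ[k] algebraMap z (Hp z ω nt At) a := rfl
  have hcomm (f : RatFunc k) (a : z) (t : RatFunc k ⊗[k] Hp z ω nt At) :
      Commute (f ⊗ₜ[k] algebraMap z (Hp z ω nt At) a) t := by
    induction t with
    | zero => exact Commute.zero_right _
    | add s t hs ht => exact hs.add_right ht
    | tmul g b =>
      rw [Commute, SemiconjBy, Algebra.TensorProduct.tmul_mul_tmul,
        Algebra.TensorProduct.tmul_mul_tmul, mul_comm f, Algebra.commutes]
  have hpK : (pPoly z nt At).eval₂ ι ((1 : RatFunc k) ⊗ₜ[k] Kp z ω nt At) = 0 := by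
    have := congrArg (Algebra.TensorProduct.includeRight (R := k) (A := RatFunc k)).toRingHom
      (eval₂_pPoly_Kp z ω nt At)
    rwa [Polynomial.hom_eval₂, map_zero] at this
  have hx (t : RatFunc k ⊗[k] Hp z ω nt At) : Commute ((RatFunc.X : RatFunc k) ⊗ₜ[k] 1) t := by
    simpa using hcomm RatFunc.X 1 t
  obtain ⟨h1, h2⟩ := sum_horner_of_factor z ι (hcomm 1) (hcomm RatFunc.X xi) hfac hpK hx hxi
    (by simp [hιa]) (φ := phiT k z xi A) (φt := phiT k z xi At) rfl (fun _ => rfl) rfl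
    (fun _ => rfl)
  have hr : (∑ jj ∈ Finset.range (r.natDegree + 1), ((RatFunc.X : RatFunc k) ^ jj) ⊗ₜ[k]
      algebraMap z (Hp z ω nt At) (r.coeff jj * xi ^ jj)) =
      r.eval₂ ι ((RatFunc.X : RatFunc k) ⊗ₜ[k] algebraMap z (Hp z ω nt At) xi) := by
    rw [Polynomial.eval₂_eq_sum_range]
    simp [hιa]
  have hXsmul (t : RatFunc k ⊗[k] Hp z ω nt At) :
      (RatFunc.X : RatFunc k) • t = ((RatFunc.X : RatFunc k) ⊗ₜ[k] 1) * t := by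
    rw [Algebra.smul_def, Algebra.TensorProduct.algebraMap_apply, Algebra.algebraMap_self_apply]
  have hΘ1 (b : Hp z ω n A) : Θ ((1 : RatFunc k) ⊗ₜ[k] b) = (1 : RatFunc k) ⊗ₜ[k] θ b := by
    simp [hΘ]
  rw [KxMain_eq, KxMain_eq, hr]
  simp only [map_add, map_sum, map_mul, hsmul, map_sub, hphi, hΘ1, map_pow, hK, hz]
  simp only [← map_mul, ← hιa, hXsmul, mul_add, mul_smul_comm, ← h2]
  congr 1

end Baxterization
end
end

section
/- Suppose ξ is invertible in 𝔷, define the polynomial p_ξ(u) := ξ^{−(n+1)} p(ξu), and put ζ := ξ⁻¹ p(0). The correspondence K ↦ ξK defines an algebra isomorphism 𝒦_p(x) → 𝒦_{p_ξ}(x), and this isomorphism sends the principal baxterized element K_p(ξ,ζ,x) to ξ^n · K_{p_ξ}(1, p_ξ(0), x). -/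
noncomputable section
namespace Baxterization
open scoped TensorProduct

/-! ## The affine Hecke algebra of rank one -/

variable (k : Type) [Field k]
variable (z : Type) [CommRing z] [Algebra k z]

variable (ω : z)

variable {B : Type} [Ring B] [Algebra k B]

variable [Algebra z B]

lemma Rg_mul_Rg : Rg z ω * Rg z ω = ω • Rg z ω + 1 := by
  have h := RingQuot.mkAlgHom_rel z (HRel.hecke (z := z) (ω := ω))
  rw [map_mul, map_add, map_smul, map_one] at h
  exact h

lemma reflection_equation :
    Rg z ω * Kg z ω * Rg z ω * Kg z ω = Kg z ω * Rg z ω * Kg z ω * Rg z ω := by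
  have h := RingQuot.mkAlgHom_rel z (HRel.re (z := z) (ω := ω))
  simp only [map_mul] at h
  exact h

/-- The quotient map from the affine to the cyclotomic Hecke algebra. -/
def toHp (n : ℕ) (A : ℕ → z) : H z ω →ₐ[z] Hp z ω n A := RingQuot.mkAlgHom z (CRel z ω n A)

lemma toHp_pKelt (n : ℕ) (A : ℕ → z) : toHp z ω n A (pKelt z ω n A) = 0 :=
  (RingQuot.mkAlgHom_rel z (CRel.mk (z := z) (ω := ω) (n := n) (A := A))).trans (map_zero _)

/-- Rescaling of the generator `K` by a central scalar `c` in the affine Hecke algebra. -/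
def rescaleH (c : z) : H z ω →ₐ[z] H z ω :=
  RingQuot.liftAlgHom z ⟨FreeAlgebra.lift z fun g => G.rec (Rg z ω) (c • Kg z ω) g, by
    rintro _ _ (_ | _)
    · simpa using Rg_mul_Rg z ω
    · simp [reflection_equation]⟩

lemma rescaleH_Rg (c : z) : rescaleH z ω c (Rg z ω) = Rg z ω := by
  refine (RingQuot.liftAlgHom_mkAlgHom_apply z _ _ _).trans ?_
  simp

lemma rescaleH_Kg (c : z) : rescaleH z ω c (Kg z ω) = c • Kg z ω := by
  refine (RingQuot.liftAlgHom_mkAlgHom_apply z _ _ _).trans ?_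
  simp

lemma rescaleH_pKelt (n : ℕ) {A B : ℕ → z} {c : z} (h : ∀ i, A i = c ^ (i + 1) * B i) :
    rescaleH z ω c (pKelt z ω n A) = c ^ (n + 1) • pKelt z ω n B := by
  simp only [pKelt, map_add, map_neg, map_pow, map_sum, map_smul, rescaleH_Kg, smul_pow,
    smul_add, smul_neg, Finset.smul_sum, smul_smul]
  congr 1
  refine Finset.sum_congr rfl fun i hi => ?_
  obtain ⟨j, rfl⟩ := Nat.exists_eq_add_of_le (Finset.mem_range_succ_iff.mp hi)
  rw [h, Nat.add_sub_cancel_left]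
  congr 1
  ring

/-- Rescaling of the generator `K` by a scalar `c`, as a homomorphism of cyclotomic Hecke
algebras. -/
def rescaleHp (n : ℕ) {A B : ℕ → z} {c : z} (h : ∀ i, A i = c ^ (i + 1) * B i) :
    Hp z ω n A →ₐ[z] Hp z ω n B :=
  RingQuot.liftAlgHom z
    ⟨(toHp z ω n B).comp (rescaleH z ω c), by
      rintro _ _ ⟨⟩
      simp [rescaleH_pKelt z ω n h, toHp_pKelt]⟩

lemma rescaleHp_Rp (n : ℕ) {A B : ℕ → z} {c : z} (h : ∀ i, A i = c ^ (i + 1) * B i) :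
    rescaleHp z ω n h (Rp z ω n A) = Rp z ω n B := by
  refine (RingQuot.liftAlgHom_mkAlgHom_apply z _ _ _).trans ?_
  exact congrArg (toHp z ω n B) (rescaleH_Rg z ω c)

lemma rescaleHp_Kp (n : ℕ) {A B : ℕ → z} {c : z} (h : ∀ i, A i = c ^ (i + 1) * B i) :
    rescaleHp z ω n h (Kp z ω n A) = c • Kp z ω n B := by
  refine (RingQuot.liftAlgHom_mkAlgHom_apply z _ _ _).trans ?_
  exact (congrArg (toHp z ω n B) (rescaleH_Kg z ω c)).trans (map_smul _ _ _)

variable {z ω} in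
lemma Hp_algHom_ext {n : ℕ} {A : ℕ → z} {C : Type} [Ring C] [Algebra z C]
    {f g : Hp z ω n A →ₐ[z] C} (hR : f (Rp z ω n A) = g (Rp z ω n A))
    (hK : f (Kp z ω n A) = g (Kp z ω n A)) : f = g := by
  refine RingQuot.ringQuot_ext' z f g (RingQuot.ringQuot_ext' z _ _ ?_)
  ext (_ | _)
  · exact hR
  · exact hK

/-- Rescaling of the generator `K` by an invertible scalar `c`, as an isomorphism of cyclotomic
Hecke algebras. -/
def rescaleEquiv (n : ℕ) {A B : ℕ → z} {c d : z} (hcd : c * d = 1)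
    (h : ∀ i, A i = c ^ (i + 1) * B i) (h' : ∀ i, B i = d ^ (i + 1) * A i) :
    Hp z ω n A ≃ₐ[z] Hp z ω n B :=
  AlgEquiv.ofAlgHom (rescaleHp z ω n h) (rescaleHp z ω n h')
    (Hp_algHom_ext (by simp [rescaleHp_Rp])
      (by simp [rescaleHp_Kp, smul_smul, mul_comm d c, hcd]))
    (Hp_algHom_ext (by simp [rescaleHp_Rp]) (by simp [rescaleHp_Kp, smul_smul, hcd]))

variable {k z} in
lemma mul_one_tmul_algebraMap {C : Type} [Ring C] [Algebra k C] [Algebra z C] (c : z)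
    (t : RatFunc k ⊗[k] C) :
    t * ((1 : RatFunc k) ⊗ₜ[k] algebraMap z C c) =
      ((1 : RatFunc k) ⊗ₜ[k] algebraMap z C c) * t := by
  induction t with
  | zero => simp
  | tmul f b => simp [Algebra.commutes]
  | add s t hs ht => rw [add_mul, mul_add, hs, ht]

variable {k z} in
lemma map_phiT {B C : Type} [Ring B] [Algebra k B] [Algebra z B] [Ring C] [Algebra k C]
    [Algebra z C] (Θ : RatFunc k ⊗[k] B →ₐ[k] RatFunc k ⊗[k] C)
    (hΘ : ∀ (f : RatFunc k) (a : z),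
      Θ (f ⊗ₜ[k] algebraMap z B a) = f ⊗ₜ[k] algebraMap z C a)
    {a a' : ℕ → z} {c : z} (h : ∀ i, a i = c ^ (i + 1) * a' i) (i : ℕ) :
    Θ (phiT k z (B := B) c a i) =
      ((1 : RatFunc k) ⊗ₜ[k] algebraMap z C (c ^ i)) * phiT k z (B := C) 1 a' i := by
  induction i with
  | zero => simp [phiT, ← Algebra.TensorProduct.one_def]
  | succ i ih =>
    have comm : (RatFunc.X : RatFunc k) ⊗ₜ[k] algebraMap z C c =
        ((1 : RatFunc k) ⊗ₜ[k] algebraMap z C c) *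
          ((RatFunc.X : RatFunc k) ⊗ₜ[k] algebraMap z C 1) := by simp
    rw [phiT, phiT, map_sub, map_mul, ih, hΘ, hΘ, comm, mul_sub, h]
    congr 1
    · rw [← mul_assoc, mul_assoc _ _ (1 ⊗ₜ[k] algebraMap z C c), mul_one_tmul_algebraMap, ← mul_assoc,
        ← mul_assoc, Algebra.TensorProduct.tmul_mul_tmul, ← map_mul, ← pow_succ, one_mul]
    · rw [Algebra.TensorProduct.tmul_mul_tmul, ← map_mul, one_mul]

/-- Suppose ξ is invertible in 𝔷 (with inverse η), let
p_ξ(u) = ξ^{−(n+1)}p(ξu), i.e. the polynomial with coefficients A_i η^{i+1}, and put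
ζ = ξ⁻¹p(0) = ηAₙ. The correspondence K ↦ ξK defines an algebra isomorphism
𝒦_p(x) → 𝒦_{p_ξ}(x) (extending to H_p(x) → H_{p_ξ}(x)) sending K_p(ξ,ζ,x) to
ξⁿ·K_{p_ξ}(1, p_ξ(0), x). -/
theorem rescaling_of_principal_solution [CharZero k]
    (q : k) (hq0 : q ≠ 0) (hq1 : q ≠ 1) (hq1' : q ≠ -1)
    (hω : ω = algebraMap k z (q - q⁻¹))
    (n : ℕ) (hn : 1 ≤ n) (A : ℕ → z) (xi eta : z) (heta : xi * eta = 1) :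
    ∃ θ : Hp z ω n A ≃ₐ[z] Hp z ω n (fun i => A i * eta ^ (i + 1)),
      θ (Rp z ω n A) = Rp z ω n (fun i => A i * eta ^ (i + 1)) ∧
      θ (Kp z ω n A) =
        algebraMap z (Hp z ω n (fun i => A i * eta ^ (i + 1))) xi *
          Kp z ω n (fun i => A i * eta ^ (i + 1)) ∧
      ∀ Θ : (RatFunc k ⊗[k] Hp z ω n A) →ₐ[k]
          (RatFunc k ⊗[k] Hp z ω n (fun i => A i * eta ^ (i + 1))),
        (∀ (f : RatFunc k) (h : Hp z ω n A), Θ (f ⊗ₜ[k] h) = f ⊗ₜ[k] θ h) →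
        Θ (KxMain k z ω n A xi (eta * A n)) =
          ((1 : RatFunc k) ⊗ₜ[k]
              algebraMap z (Hp z ω n (fun i => A i * eta ^ (i + 1))) (xi ^ n)) *
            KxMain k z ω n (fun i => A i * eta ^ (i + 1)) 1 (A n * eta ^ (n + 1)) := by
  have hξη (m : ℕ) : xi ^ m * eta ^ m = 1 := by rw [← mul_pow, heta, one_pow]
  have hA (i : ℕ) : A i = xi ^ (i + 1) * (A i * eta ^ (i + 1)) := by
    linear_combination -A i * hξη (i + 1)
  refine ⟨rescaleEquiv z ω n heta hA fun i => mul_comm _ _, rescaleHp_Rp z ω n hA,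
    (rescaleHp_Kp z ω n hA).trans (Algebra.smul_def _ _), fun Θ hΘ => ?_⟩
  have hΘz (f : RatFunc k) (a : z) : Θ (f ⊗ₜ[k] algebraMap z _ a) = f ⊗ₜ[k] algebraMap z _ a := by
    rw [hΘ, AlgEquiv.commutes]
  have hφ := map_phiT Θ hΘz hA
  have hsmul (f : RatFunc k) (t : RatFunc k ⊗[k] Hp z ω n A) : Θ (f • t) = f • Θ t := by
    induction t with
    | zero => simp
    | tmul g b => rw [TensorProduct.smul_tmul', hΘ, hΘ, TensorProduct.smul_tmul']
    | add s t hs ht => rw [smul_add, map_add, hs, ht, map_add, smul_add]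
  rw [KxMain, KxMain, map_add, map_sum, hsmul, map_sub, hsmul, hφ, hΘz, mul_add, Finset.mul_sum,
    mul_smul_comm, mul_sub, mul_smul_comm]
  congr 1
  · refine Finset.sum_congr rfl fun i hi => ?_
    have hK : Θ ((1 : RatFunc k) ⊗ₜ[k] Kp z ω n A) =
        ((1 : RatFunc k) ⊗ₜ[k] algebraMap z _ xi) *
          ((1 : RatFunc k) ⊗ₜ[k] Kp z ω n (fun i => A i * eta ^ (i + 1))) := by
      have hθ : rescaleEquiv z ω n heta hA (fun i => mul_comm _ _) (Kp z ω n A) = _ :=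
        rescaleHp_Kp z ω n hA
      rw [hΘ, hθ, Algebra.smul_def, Algebra.TensorProduct.tmul_mul_tmul, one_mul]
    have hcomm := (mul_one_tmul_algebraMap xi
      ((1 : RatFunc k) ⊗ₜ[k] Kp z ω n (fun i => A i * eta ^ (i + 1)))).symm
    rw [map_mul, map_pow, hφ, hK, Commute.mul_pow hcomm, Algebra.TensorProduct.tmul_pow,
      one_pow, ← map_pow, mul_assoc, ← mul_assoc (phiT _ _ _ _ _), mul_one_tmul_algebraMap,
      mul_assoc, ← mul_assoc, Algebra.TensorProduct.tmul_mul_tmul, ← map_mul, ← pow_add, one_mul,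
      Nat.add_sub_cancel' (Finset.mem_range.mp hi).le]
  · congr 2
    rw [Algebra.TensorProduct.tmul_mul_tmul, ← map_mul, one_mul]
    congr 2
    linear_combination -eta * A n * hξη n

end Baxterization
end
end

section
/- Let ξ, ζ ∈ 𝔷 with ξζ = p(0) = A_n, and define ψ(ξ,ζ,x) := (−ξ^n x^{n+1} + Σ_{i=0}^{n−1} A_i ξ^{n−1−i} x^{n−i} + ζ)/(x − x⁻¹) ∈ 𝔷(x) (so that ξ·ψ(ξ,ζ,x)·(x − x⁻¹) = p(ξx)). Then the principal baxterized element satisfies K_p(ξ,ζ,x) · K_p(ξ,ζ,x⁻¹) = ψ(ξ,ζ,x) · ψ(ξ,ζ,x⁻¹) in 𝒦_p(x); in particular this product is a scalar, i.e. it lies in 𝔷(x)·1. -/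
noncomputable section
namespace Baxterization
open scoped TensorProduct

/-! ## The affine Hecke algebra of rank one -/

variable (k : Type) [Field k]
variable (z : Type) [CommRing z] [Algebra k z]

variable (ω : z)

variable {B : Type} [Ring B] [Algebra k B]

variable [Algebra z B]

section CommutativeIdentity

variable {C : Type*} [CommRing C]

/-- Closed form of the sequence `f 0 = 1`, `f (i + 1) = f i * (ξ x) - a i`. -/
lemma phi_closed_form (x ξ : C) (a f : ℕ → C) (f0 : f 0 = 1)
    (fs : ∀ i, f (i + 1) = f i * (x * ξ) - a i) (n : ℕ) :
    x * f n = x ^ (n + 1) * ξ ^ n -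
      ∑ i ∈ Finset.range n, x ^ (n - i) * (a i * ξ ^ (n - 1 - i)) := by
  induction n with
  | zero => simp [f0]
  | succ n ih =>
    have hsum : ∑ i ∈ Finset.range n, x ^ (n + 1 - i) * (a i * ξ ^ (n + 1 - 1 - i)) =
        x * ξ * ∑ i ∈ Finset.range n, x ^ (n - i) * (a i * ξ ^ (n - 1 - i)) := by
      rw [Finset.mul_sum]
      refine Finset.sum_congr rfl fun i hi => ?_
      have hi := Finset.mem_range.mp hi
      rw [show n + 1 - i = n - i + 1 by omega, show n + 1 - 1 - i = n - 1 - i + 1 by omega]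
      ring
    rw [Finset.sum_range_succ, hsum, fs]
    simp only [Nat.add_sub_cancel, Nat.sub_self, Nat.add_sub_cancel_left]
    linear_combination (x * ξ) * ih

/-- Horner sums `∑_{i ≤ n} f i u^(n-i)`. -/
def horner (u : C) (f : ℕ → C) : ℕ → C
  | 0 => f 0
  | n + 1 => u * horner u f n + f (n + 1)

lemma sum_mul_pow_sub_succ (u : C) (f : ℕ → C) (n : ℕ) :
    ∑ i ∈ Finset.range (n + 1), f i * u ^ (n + 1 - i) =
      u * ∑ i ∈ Finset.range (n + 1), f i * u ^ (n - i) := by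
  rw [Finset.mul_sum]
  refine Finset.sum_congr rfl fun i hi => ?_
  rw [Nat.succ_sub (Nat.lt_succ_iff.mp (Finset.mem_range.mp hi)), pow_succ]
  ring

lemma horner_eq_sum (u : C) (f : ℕ → C) (n : ℕ) :
    horner u f n = ∑ i ∈ Finset.range (n + 1), f i * u ^ (n - i) := by
  induction n with
  | zero => simp [horner]
  | succ n ih =>
    rw [Finset.sum_range_succ, sum_mul_pow_sub_succ, horner, ih]
    simp

lemma sub_mul_horner (u t : C) (a f : ℕ → C) (f0 : f 0 = 1)
    (fs : ∀ i, f (i + 1) = f i * t - a i) (n : ℕ) :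
    (u - t) * horner u f n = u ^ (n + 1) - horner u a n - f (n + 1) := by
  induction n with
  | zero => simp [horner, fs, f0]
  | succ n ih =>
    rw [horner, horner, fs (n + 1)]
    linear_combination u * ih

/-- The quotient of `horner u f n - horner v f n` by `u - v`. -/
def hornerQuot (u v : C) (f : ℕ → C) : ℕ → C
  | 0 => 0
  | n + 1 => u * hornerQuot u v f n + horner v f n

lemma sub_mul_hornerQuot (u v : C) (f : ℕ → C) (n : ℕ) :
    (u - v) * hornerQuot u v f n = horner u f n - horner v f n := by
  induction n with
  | zero => simp [horner, hornerQuot]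
  | succ n ih =>
    simp only [horner, hornerQuot]
    linear_combination u * ih

lemma sub_mul_horner_inv (x y ξ : C) (a f g : ℕ → C)
    (f0 : f 0 = 1) (fs : ∀ i, f (i + 1) = f i * (x * ξ) - a i)
    (g0 : g 0 = 1) (gs : ∀ i, g (i + 1) = g i * (y * ξ) - a i) (n : ℕ) :
    (x - y) * horner (y * ξ) f n = x * f n - y * g n := by
  induction n with
  | zero => simp [horner, f0, g0]
  | succ n ih =>
    rw [horner, fs, gs]
    linear_combination (y * ξ) * ih

lemma horner_sub_horner (x y ξ u : C) (a f g : ℕ → C)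
    (f0 : f 0 = 1) (fs : ∀ i, f (i + 1) = f i * (x * ξ) - a i)
    (g0 : g 0 = 1) (gs : ∀ i, g (i + 1) = g i * (y * ξ) - a i) (n : ℕ) :
    horner u f n - horner u g n = ξ * (x - y) * hornerQuot u (y * ξ) f n := by
  induction n with
  | zero => simp [horner, hornerQuot, f0, g0]
  | succ n ih =>
    have h := sub_mul_horner_inv x y ξ a f g f0 fs g0 gs n
    simp only [horner, hornerQuot]
    rw [fs, gs]
    linear_combination u * ih - ξ * h

/-- The unitarity relation before imposing the polynomial relation on `u`: both sides differ by
a multiple of the characteristic polynomial. -/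
lemma unitarity_identity (x y e ξ ζ u : C) (he : (x - y) * e = 1) (a f g : ℕ → C)
    (f0 : f 0 = 1) (fs : ∀ i, f (i + 1) = f i * (x * ξ) - a i)
    (g0 : g 0 = 1) (gs : ∀ i, g (i + 1) = g i * (y * ξ) - a i) (n : ℕ) (hξ : ξ * ζ = a n) :
    ((∑ i ∈ Finset.range n, f i * u ^ (n - i)) + e * (ζ - y * f n)) *
        ((∑ i ∈ Finset.range n, g i * u ^ (n - i)) + -e * (ζ - x * g n)) =
      (e * (ζ - x * f n)) * (-e * (ζ - y * g n)) -
        hornerQuot u (y * ξ) f n *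
          (-u ^ (n + 1) + ∑ i ∈ Finset.range (n + 1), a i * u ^ (n - i)) := by
  have hf := horner_eq_sum u f n
  have hg := horner_eq_sum u g n
  rw [Finset.sum_range_succ, Nat.sub_self, pow_zero, mul_one] at hf hg
  have hK : (∑ i ∈ Finset.range n, f i * u ^ (n - i)) + e * (ζ - y * f n) =
      horner u f n + e * (ζ - x * f n) := by
    linear_combination -hf + f n * he
  have hK' : (∑ i ∈ Finset.range n, g i * u ^ (n - i)) + -e * (ζ - x * g n) =
      horner u g n + -e * (ζ - y * g n) := by
    linear_combination -hg + g n * he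
  rw [hK, hK', ← horner_eq_sum u a n]
  have h1 := sub_mul_horner u (y * ξ) a g g0 gs n
  have h2 := sub_mul_hornerQuot u (y * ξ) f n
  have h3 := sub_mul_horner_inv x y ξ a f g f0 fs g0 gs n
  have h4 := horner_sub_horner x y ξ u a f g f0 fs g0 gs n
  have h5 : horner (y * ξ) f n = e * (x * f n - y * g n) := by
    linear_combination e * h3 - horner (y * ξ) f n * he
  rw [gs] at h1
  rw [h5] at h2
  linear_combination (-e * (ζ - y * g n)) * h4 - horner u g n * h2 +
    hornerQuot u (y * ξ) f n * (h1 - hξ) -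
    ξ * hornerQuot u (y * ξ) f n * (ζ - y * g n) * he

end CommutativeIdentity

section BaseChange

variable {B' : Type} [Ring B'] [Algebra k B'] [Algebra z B']

lemma map_phiT_s16 {L : Type*} [FunLike L (RatFunc k ⊗[k] B) (RatFunc k ⊗[k] B')]
    [RingHomClass L (RatFunc k ⊗[k] B) (RatFunc k ⊗[k] B')] (F : L)
    (hF : ∀ (r : RatFunc k) (a : z),
      F (r ⊗ₜ[k] algebraMap z B a) = r ⊗ₜ[k] algebraMap z B' a)
    (ξ : z) (A : ℕ → z) (i : ℕ) :
    F (phiT k z (B := B) ξ A i) = phiT k z (B := B') ξ A i := by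
  induction i with
  | zero => simp [phiT]
  | succ i ih => simp only [phiT, map_sub, map_mul, ih, hF]

/-- Evaluation of the polynomial variable at `K`, extended to rational functions of `x`. -/
def evalK (n : ℕ) (A : ℕ → z) :
    RatFunc k ⊗[k] Polynomial z →ₐ[RatFunc k] RatFunc k ⊗[k] Hp z ω n A :=
  Algebra.TensorProduct.map (AlgHom.id (RatFunc k) (RatFunc k))
    ((Polynomial.aeval (R := z) (Kp z ω n A)).restrictScalars k)

lemma evalK_tmul (n : ℕ) (A : ℕ → z) (r : RatFunc k) (f : Polynomial z) :
    evalK k z ω n A (r ⊗ₜ[k] f) = r ⊗ₜ[k] Polynomial.aeval (Kp z ω n A) f := by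
  simp [evalK]

lemma map_evalK (n : ℕ) (A : ℕ → z) (σ : RatFunc k →ₐ[k] RatFunc k)
    (c : RatFunc k ⊗[k] Polynomial z) :
    Algebra.TensorProduct.map σ (AlgHom.id k (Hp z ω n A)) (evalK k z ω n A c) =
      evalK k z ω n A (Algebra.TensorProduct.map σ (AlgHom.id k (Polynomial z)) c) := by
  induction c with
  | zero => simp
  | tmul r f => simp [evalK_tmul]
  | add a b ha hb => simp only [map_add, ha, hb]

lemma aeval_pPoly_Kp (n : ℕ) (A : ℕ → z) :
    Polynomial.aeval (Kp z ω n A) (pPoly z n A) = 0 := by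
  have h : RingQuot.mkAlgHom z (CRel z ω n A) (pKelt z ω n A) =
      RingQuot.mkAlgHom z (CRel z ω n A) 0 := RingQuot.mkAlgHom_rel z CRel.mk
  have h' : Polynomial.aeval (Kp z ω n A) (pPoly z n A) =
      RingQuot.mkAlgHom z (CRel z ω n A) (pKelt z ω n A) := by
    simp only [pPoly, pKelt, map_add, map_neg, map_sum, map_mul, map_pow,
      Polynomial.aeval_X, Polynomial.aeval_C, Algebra.smul_def, AlgHom.commutes]
    rfl
  rw [h', h]
  exact map_zero _

lemma isScalarElt_tmul (r : RatFunc k) (a : z) :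
    IsScalarElt k z (r ⊗ₜ[k] algebraMap z B a) := by
  have h : r ⊗ₜ[k] algebraMap z B a = r • ((1 : RatFunc k) ⊗ₜ[k] algebraMap z B a) := by
    rw [TensorProduct.smul_tmul', smul_eq_mul, mul_one]
  rw [h]
  exact Submodule.smul_mem _ _ (Submodule.subset_span ⟨a, rfl⟩)

lemma IsScalarElt.mul {c d : RatFunc k ⊗[k] B} (hc : IsScalarElt k z c)
    (hd : IsScalarElt k z d) : IsScalarElt k z (c * d) := by
  have h := Submodule.mul_mem_mul hc hd
  rw [Submodule.span_mul_span] at h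
  refine Submodule.span_mono ?_ h
  rintro _ ⟨_, ⟨a, rfl⟩, _, ⟨b, rfl⟩, rfl⟩
  exact ⟨a * b, by simp⟩

lemma IsScalarElt.map (σ : RatFunc k →ₐ[k] RatFunc k) {c : RatFunc k ⊗[k] B}
    (hc : IsScalarElt k z c) :
    IsScalarElt k z (Algebra.TensorProduct.map σ (AlgHom.id k B) c) := by
  refine Submodule.span_induction ?_ ?_ ?_ ?_ hc
  · rintro _ ⟨a, rfl⟩
    simpa using isScalarElt_tmul k z (B := B) 1 a
  · rw [map_zero]
    exact Submodule.zero_mem _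
  · intro a b _ _ ha hb
    rw [map_add]
    exact Submodule.add_mem _ ha hb
  · intro r a _ ha
    have h : r • a = (r ⊗ₜ[k] (1 : B)) * a := Algebra.smul_def r a
    rw [h, map_mul, Algebra.TensorProduct.map_tmul, map_one,
      show (σ r ⊗ₜ[k] (1 : B)) = algebraMap (RatFunc k) (RatFunc k ⊗[k] B) (σ r) from rfl,
      ← Algebra.smul_def]
    exact Submodule.smul_mem _ _ ha

lemma isScalarElt_psiT (n : ℕ) (A : ℕ → z) (ξ ζ : z) :
    IsScalarElt k z (psiT k z ω n A ξ ζ) :=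
  Submodule.smul_mem _ _ (Submodule.sub_mem _ (Submodule.add_mem _
    (Submodule.sum_mem _ fun _ _ => isScalarElt_tmul k z _ _) (isScalarElt_tmul k z _ _))
    (isScalarElt_tmul k z _ _))

end BaseChange

/-- unitarity relation. For ξζ = p(0) = Aₙ and
ψ(ξ,ζ,x) = (−ξⁿx^{n+1} + Σ_{i=0}^{n−1} A_iξ^{n−1−i}x^{n−i} + ζ)/(x − x⁻¹), the principal
baxterized element satisfies K_p(ξ,ζ,x)·K_p(ξ,ζ,x⁻¹) = ψ(ξ,ζ,x)·ψ(ξ,ζ,x⁻¹);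
in particular this product lies in 𝔷(x)·1. -/
theorem principal_solution_normalization [CharZero k]
    (q : k) (hq0 : q ≠ 0) (hq1 : q ≠ 1) (hq1' : q ≠ -1)
    (hω : ω = algebraMap k z (q - q⁻¹))
    (n : ℕ) (hn : 1 ≤ n) (A : ℕ → z) (xi zeta : z) (hxz : xi * zeta = A n) :
    ∀ σ : RatFunc k →ₐ[k] RatFunc k, σ RatFunc.X = RatFunc.X⁻¹ →
      KxMain k z ω n A xi zeta *
          Algebra.TensorProduct.map σ (AlgHom.id k (Hp z ω n A))
            (KxMain k z ω n A xi zeta) =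
        psiT k z ω n A xi zeta *
          Algebra.TensorProduct.map σ (AlgHom.id k (Hp z ω n A))
            (psiT k z ω n A xi zeta) ∧
      IsScalarElt k z
        (KxMain k z ω n A xi zeta *
          Algebra.TensorProduct.map σ (AlgHom.id k (Hp z ω n A))
            (KxMain k z ω n A xi zeta)) := by
  intro σ hσ
  have hX : (RatFunc.X : RatFunc k) ≠ 0 := RatFunc.X_ne_zero
  have hD : (RatFunc.X - RatFunc.X⁻¹ : RatFunc k) ≠ 0 := by
    intro h
    have h2 : (RatFunc.X : RatFunc k) ^ 2 = 1 := by
      field_simp at h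
      linear_combination h
    have h3 : (Polynomial.X ^ 2 : Polynomial k) = 1 := by
      apply RatFunc.algebraMap_injective k
      simpa using h2
    simpa using congrArg Polynomial.natDegree h3
  let Sc : RatFunc k →+* RatFunc k ⊗[k] Polynomial z := algebraMap _ _
  let Sz : z →+* RatFunc k ⊗[k] Polynomial z :=
    (Algebra.TensorProduct.includeRight (R := k) (A := RatFunc k)
      (B := Polynomial z)).toRingHom.comp Polynomial.C
  have hSc : ∀ r, Sc r = r ⊗ₜ[k] (1 : Polynomial z) := fun _ => rfl
  have hSz : ∀ a, Sz a = (1 : RatFunc k) ⊗ₜ[k] Polynomial.C a := fun _ => rfl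
  let τ := Algebra.TensorProduct.map σ (AlgHom.id k (Polynomial z))
  have hτc : ∀ r, τ (Sc r) = Sc (σ r) := fun r => by simp [τ, hSc]
  have hτz : ∀ a, τ (Sz a) = Sz a := fun a => by simp [τ, hSz]
  have hEc : ∀ r, evalK k z ω n A (Sc r) = algebraMap _ _ r := (evalK k z ω n A).commutes
  let x := Sc RatFunc.X
  let y := Sc RatFunc.X⁻¹
  let e := Sc (RatFunc.X - RatFunc.X⁻¹)⁻¹
  let u : RatFunc k ⊗[k] Polynomial z := (1 : RatFunc k) ⊗ₜ[k] Polynomial.X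
  let f := phiT k z (B := Polynomial z) xi A
  let g := fun i => τ (f i)
  have he : (x - y) * e = 1 := by
    simp only [x, y, e]
    rw [← map_sub, ← map_mul, mul_inv_cancel₀ hD, map_one]
  have hτx : τ x = y := by simp only [x, y, hτc, hσ]
  have hτy : τ y = x := by simp only [x, y, hτc, map_inv₀, hσ, inv_inv]
  have hτe : τ e = -e := by
    have h : σ (RatFunc.X - RatFunc.X⁻¹)⁻¹ = -(RatFunc.X - RatFunc.X⁻¹)⁻¹ := by
      rw [map_inv₀, map_sub, map_inv₀, hσ, inv_inv, ← neg_sub, inv_neg]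
    simp only [e, hτc, h, map_neg]
  have hτu : τ u = u := by simp [τ, u]
  have f0 : f 0 = 1 := rfl
  have fs : ∀ i, f (i + 1) = f i * (x * Sz xi) - Sz (A i) := fun i => by
    simp [f, phiT, x, hSc, hSz]
  have g0 : g 0 = 1 := map_one τ
  have gs : ∀ i, g (i + 1) = g i * (y * Sz xi) - Sz (A i) := fun i => by
    simp only [g, fs, map_sub, map_mul, hτx, hτz]
  have key := unitarity_identity x y e (Sz xi) (Sz zeta) u he (fun i => Sz (A i)) f g
    f0 fs g0 gs n (by rw [← map_mul, hxz])
  have hp : evalK k z ω n A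
      (-u ^ (n + 1) + ∑ i ∈ Finset.range (n + 1), Sz (A i) * u ^ (n - i)) = 0 := by
    have h : -u ^ (n + 1) + ∑ i ∈ Finset.range (n + 1), Sz (A i) * u ^ (n - i) =
        (1 : RatFunc k) ⊗ₜ[k] pPoly z n A := by
      simp [u, hSz, pPoly, TensorProduct.tmul_add, TensorProduct.tmul_neg,
        TensorProduct.tmul_sum]
    rw [h, evalK_tmul, aeval_pPoly_Kp, TensorProduct.tmul_zero]
  have hKx : KxMain k z ω n A xi zeta = evalK k z ω n A
      ((∑ i ∈ Finset.range n, f i * u ^ (n - i)) + e * (Sz zeta - y * f n)) := by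
    have hφ : ∀ i, evalK k z ω n A (f i) = phiT k z (B := Hp z ω n A) xi A i :=
      map_phiT_s16 k z (evalK k z ω n A) (fun r a => by simp [evalK_tmul]) xi A
    simp only [map_add, map_sub, map_mul, map_sum, map_pow, hφ, hEc, KxMain, e, y,
      Algebra.smul_def, u, hSz, evalK_tmul, Polynomial.aeval_C,
      Polynomial.aeval_X, Algebra.TensorProduct.tmul_pow, one_pow]
  have hψ : psiT k z ω n A xi zeta = evalK k z ω n A (e * (Sz zeta - x * f n)) := by
    rw [phi_closed_form x (Sz xi) (fun i => Sz (A i)) f f0 fs n]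
    have h : Sz zeta - (x ^ (n + 1) * Sz xi ^ n - ∑ i ∈ Finset.range n,
        x ^ (n - i) * (Sz (A i) * Sz xi ^ (n - 1 - i))) =
        (∑ i ∈ Finset.range n,
          (RatFunc.X ^ (n - i)) ⊗ₜ[k] Polynomial.C (A i * xi ^ (n - 1 - i))) +
        (1 : RatFunc k) ⊗ₜ[k] Polynomial.C zeta -
        (RatFunc.X ^ (n + 1)) ⊗ₜ[k] Polynomial.C (xi ^ n) := by
      simp [x, hSc, hSz]
      ring
    rw [h, map_mul, hEc, psiT, ← Algebra.smul_def]
    simp only [map_add (evalK k z ω n A), map_sub (evalK k z ω n A), map_sum (evalK k z ω n A),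
      evalK_tmul, Polynomial.aeval_C]
  have hmain : KxMain k z ω n A xi zeta *
        Algebra.TensorProduct.map σ (AlgHom.id k (Hp z ω n A)) (KxMain k z ω n A xi zeta) =
      psiT k z ω n A xi zeta *
        Algebra.TensorProduct.map σ (AlgHom.id k (Hp z ω n A)) (psiT k z ω n A xi zeta) := by
    rw [hKx, hψ, map_evalK, map_evalK, ← map_mul, ← map_mul]
    change evalK k z ω n A (_ * τ _) = evalK k z ω n A (_ * τ _)
    simp only [map_add τ, map_sub τ, map_mul τ, map_sum τ, map_pow τ, hτe, hτz, hτx, hτy, hτu]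
    change evalK k z ω n A (_ * ((∑ i ∈ Finset.range n, g i * u ^ (n - i)) +
      -e * (Sz zeta - x * g n))) = evalK k z ω n A (_ * (-e * (Sz zeta - y * g n)))
    rw [key, map_sub, map_mul _ (hornerQuot _ _ _ _), hp, mul_zero, sub_zero]
  refine ⟨hmain, ?_⟩
  rw [hmain]
  exact (isScalarElt_psiT k z ω n A xi zeta).mul k z
    ((isScalarElt_psiT k z ω n A xi zeta).map k z σ)

end Baxterization
end
end

section
/- Suppose 𝔷 is a field, ξ ∈ 𝔷 is non-zero, ζ = p(0)/ξ, and p(ξ) ≠ 0 as well as p(−ξ) ≠ 0. Define ψ(ξ,ζ,x) := (−ξ^n x^{n+1} + Σ_{i=0}^{n−1} A_i ξ^{n−1−i} x^{n−i} + ζ)/(x − x⁻¹), a non-zero element of 𝔷(x). Then the element K̂(x) := K_p(ξ,ζ,x)/ψ(ξ,ζ,x) ∈ 𝒦_p(x) is a unitary and regular solution of the reflection equation with spectral parameter: it satisfies K̂(x)·K̂(x⁻¹) = 1, and the rational function K̂ is defined at x = 1 and at x = −1 with K̂(1) = 1 and K̂(−1) = 1 (indeed both K_p(ξ,ζ,x)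 and ψ(ξ,ζ,x) have simple poles at x = ±1 with equal residues (1/(2ξ))·p(±ξ)). -/
noncomputable section
namespace Baxterization
open scoped TensorProduct

/-! ## The affine Hecke algebra of rank one -/

variable (k : Type) [Field k]
variable (z : Type) [CommRing z] [Algebra k z]

variable (ω : z)

variable {B : Type} [Ring B] [Algebra k B]

variable [Algebra z B]

/-- regularity of an element of B(x) at a point a, with value v: there is a representation
whose rational-function coefficients have no pole at a and evaluate there to give v. -/
def RegularAtWithValue {zf : Type} [Field zf] {B : Type} [Ring B] [Algebra zf B]
    (c : RatFunc zf ⊗[zf] B) (a : zf) (v : B) : Prop :=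
  ∃ (N : ℕ) (f : Fin N → RatFunc zf) (h : Fin N → B),
    c = ∑ i, (f i) ⊗ₜ[zf] (h i) ∧
    (∀ i, Polynomial.eval a (f i).denom ≠ 0) ∧
    ∑ i, (Polynomial.eval a (f i).num / Polynomial.eval a (f i).denom) • h i = v

/-- the scalar rational function ψ(ξ,ζ,x) ∈ 𝔷(x) (here 𝔷 is a field) -/
def psiRat {zf : Type} [Field zf] (n : ℕ) (A : ℕ → zf) (xi zeta : zf) : RatFunc zf :=
  algebraMap (Polynomial zf) (RatFunc zf)
      (- Polynomial.C (xi ^ n) * Polynomial.X ^ (n + 1) +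
        ∑ i ∈ Finset.range n,
          Polynomial.C (A i * xi ^ (n - 1 - i)) * Polynomial.X ^ (n - i) +
        Polynomial.C zeta) /
    ((RatFunc.X : RatFunc zf) - (RatFunc.X)⁻¹)

theorem commutator_mul_inverse_mul {F S : Type*} [CommRing F] [Ring S] [Algebra F S]
    {R K P : S} {w a : F} (hR : R * R = w • R + 1) (hRK : R * K * R * K = K * R * K * R)
    (hPK : P * K = 1 + a • P) (hKP : K * P = 1 + a • P) :
    K * (R * P * R) - R * P * R * K = w • (K * R * P - P * R * K) := by
  have hR1 : R * (R - w • 1) = 1 := by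
    rw [mul_sub, hR, mul_smul_comm, mul_one]; abel
  have hR2 : (R - w • 1) * R = 1 := by
    rw [sub_mul, hR, smul_mul_assoc, one_mul]; abel
  obtain ⟨R', hR'⟩ : ∃ R', R' = R - w • 1 := ⟨_, rfl⟩
  rw [← hR'] at hR1 hR2
  have hV1 : R' * P * R' * (R * (K - a • 1) * R) = 1 := by
    have : P * (K - a • 1) = 1 := by rw [mul_sub, hPK, mul_smul_comm, mul_one]; abel
    calc _ = R' * P * (R' * R) * (K - a • 1) * R := by simp only [mul_assoc]
      _ = R' * (P * (K - a • 1)) * R := by rw [hR2, mul_one, mul_assoc R']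
      _ = 1 := by rw [this, mul_one, hR2]
  have hV2 : R * (K - a • 1) * R * (R' * P * R') = 1 := by
    have : (K - a • 1) * P = 1 := by rw [sub_mul, hKP, smul_mul_assoc, one_mul]; abel
    calc _ = R * (K - a • 1) * (R * R') * P * R' := by simp only [mul_assoc]
      _ = R * ((K - a • 1) * P) * R' := by rw [hR1, mul_one, mul_assoc R]
      _ = 1 := by rw [this, mul_one, hR1]
  have hT : R * (K - a • 1) * R * K - K * (R * (K - a • 1) * R) =
      (a * w) • (K * R - R * K) := by
    have h1 : R * (K - a • 1) * R = R * K * R - a • (w • R + 1) := by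
      rw [mul_sub, sub_mul, mul_smul_comm, mul_one, smul_mul_assoc, hR]
    rw [h1, sub_mul, hRK, mul_sub]
    simp only [mul_assoc, mul_smul_comm, smul_mul_assoc, mul_add, add_mul, mul_one, one_mul]
    module
  have hV : K * (R' * P * R') - R' * P * R' * K = (a * w) • (R * P - P * R) := by
    have e1 : R' * P * R' * (K * R) * (R' * P * R') =
        R' * P * R' * R' + a • (R' * P * R' * P * R') := by
      calc _ = R' * P * R' * K * (R * R') * P * R' := by simp only [mul_assoc]
        _ = R' * P * R' * (K * P) * R' := by rw [hR1, mul_one]; simp only [mul_assoc]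
        _ = _ := by
          rw [hKP]; simp only [mul_add, add_mul, mul_smul_comm, smul_mul_assoc, mul_one, mul_assoc]
    have e2 : R' * P * R' * (R * K) * (R' * P * R') =
        R' * R' * P * R' + a • (R' * P * R' * P * R') := by
      calc _ = R' * P * (R' * R) * K * R' * P * R' := by simp only [mul_assoc]
        _ = R' * (P * K) * R' * P * R' := by rw [hR2, mul_one]; simp only [mul_assoc]
        _ = _ := by
          rw [hPK]; simp only [mul_add, add_mul, mul_smul_comm, smul_mul_assoc, mul_one, mul_assoc]
    have e3 : R' * P * R' * R' - R' * R' * P * R' = R * P - P * R := by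
      calc _ = R' * (P * R' - R' * P) * R' := by simp only [mul_sub, sub_mul, mul_assoc]
        _ = R' * (P * R - R * P) * R' := by
          congr 2; rw [hR', mul_sub, sub_mul, mul_smul_comm, smul_mul_assoc, mul_one, one_mul]; abel
        _ = R' * P * (R * R') - R' * R * P * R' := by simp only [mul_sub, sub_mul, mul_assoc]
        _ = _ := by
          rw [hR1, hR2, mul_one, one_mul, hR', mul_sub, sub_mul, mul_smul_comm, smul_mul_assoc,
            mul_one, one_mul]
          abel
    generalize R * (K - a • 1) * R = T at hV1 hV2 hT
    calc _ = R' * P * R' * T * K * (R' * P * R') - R' * P * R' * K * (T * (R' * P * R')) := by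
          rw [hV1, hV2, one_mul, mul_one]
      _ = R' * P * R' * (T * K - K * T) * (R' * P * R') := by
          simp only [mul_sub, sub_mul, mul_assoc]
      _ = (a * w) • (R' * P * R' * (K * R) * (R' * P * R') -
            R' * P * R' * (R * K) * (R' * P * R')) := by
          rw [hT, mul_smul_comm, smul_mul_assoc, mul_sub, sub_mul]
      _ = _ := by rw [e1, e2, add_sub_add_right_eq_sub, e3]
  have e6 : R * P * K = R + a • (R * P) := by
    rw [mul_assoc, hPK, mul_add, mul_one, mul_smul_comm]
  simp only [hR', mul_sub, sub_mul, mul_smul_comm, smul_mul_assoc, mul_one, one_mul, smul_sub,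
    smul_smul, ← mul_assoc, hKP, hPK, add_mul, e6] at hV ⊢
  linear_combination (norm := module) hV

theorem reflection_equation_of_inverses {F S : Type*} [Field F] [Ring S] [Algebra F S]
    {R K P Q : S} {w x y c : F} (hx : x ≠ 0) (hy : y ≠ 0) (hxy : x ≠ y) (hc : c ≠ 0)
    (hR : R * R = w • R + 1) (hRK : R * K * R * K = K * R * K * R)
    (hPl : P * (K - (c * x) • 1) = 1) (hPr : (K - (c * x) • 1) * P = 1)
    (hQl : Q * (K - (c * y) • 1) = 1) (hQr : (K - (c * y) • 1) * Q = 1) :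
    (R - (x / y)⁻¹ • (R - w • 1)) * (1 + (c * (x - x⁻¹)) • P) *
        (R - (x * y)⁻¹ • (R - w • 1)) * (1 + (c * (y - y⁻¹)) • Q) =
      (1 + (c * (y - y⁻¹)) • Q) * (R - (x * y)⁻¹ • (R - w • 1)) *
        (1 + (c * (x - x⁻¹)) • P) * (R - (x / y)⁻¹ • (R - w • 1)) := by
  have hd : x - y ≠ 0 := sub_ne_zero.mpr hxy
  have hPK : P * K = 1 + (c * x) • P := by
    rw [mul_sub, mul_smul_comm, mul_one] at hPl; rw [← hPl]; abel
  have hKP : K * P = 1 + (c * x) • P := by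
    rw [sub_mul, smul_mul_assoc, one_mul] at hPr; rw [← hPr]; abel
  have hQK : Q * K = 1 + (c * y) • Q := by
    rw [mul_sub, mul_smul_comm, mul_one] at hQl; rw [← hQl]; abel
  have hKQ : K * Q = 1 + (c * y) • Q := by
    rw [sub_mul, smul_mul_assoc, one_mul] at hQr; rw [← hQr]; abel
  have hPQ : P * Q = (c * (x - y))⁻¹ • (P - Q) := by
    have h1 : P * (K * Q) = P * K * Q := (mul_assoc _ _ _).symm
    rw [hKQ, hPK] at h1
    simp only [mul_add, add_mul, mul_one, one_mul, mul_smul_comm, smul_mul_assoc] at h1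
    rw [eq_inv_smul_iff₀ (mul_ne_zero hc hd)]
    linear_combination (norm := module) -h1
  have hQP : Q * P = (c * (x - y))⁻¹ • (P - Q) := by
    have h1 : Q * (K * P) = Q * K * P := (mul_assoc _ _ _).symm
    rw [hKP, hQK] at h1
    simp only [mul_add, add_mul, mul_one, one_mul, mul_smul_comm, smul_mul_assoc] at h1
    rw [eq_inv_smul_iff₀ (mul_ne_zero hc hd)]
    linear_combination (norm := module) h1
  have hK := commutator_mul_inverse_mul hR hRK hPK hKP
  have hRPQ : R * P * Q = (c * (x - y))⁻¹ • (R * P - R * Q) := by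
    rw [mul_assoc, hPQ, mul_smul_comm, mul_sub R]
  have hRPRQ : R * P * R * Q - Q * R * P * R = (w / (c * (x - y))) •
      ((R * P - P * R) - (R * Q - Q * R) + (c * y) • (Q * R * P - P * R * Q)) := by
    have h1 := congrArg (fun t => Q * t * Q) hK
    simp only [mul_sub, sub_mul, mul_smul_comm, smul_mul_assoc] at h1
    have e1 : Q * (K * (R * P * R)) * Q = R * P * R * Q + (c * y) • (Q * R * P * R * Q) := by
      rw [← mul_assoc, hQK]; simp only [add_mul, one_mul, smul_mul_assoc, mul_assoc]
    have e2 : Q * (R * P * R * K) * Q = Q * R * P * R + (c * y) • (Q * R * P * R * Q) := by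
      rw [← mul_assoc, mul_assoc _ K, hKQ]
      simp only [mul_add, mul_one, mul_smul_comm, mul_assoc]
    have e3 : Q * (K * R * P) * Q = (c * (x - y))⁻¹ • (R * P - R * Q) +
        (c * y * (c * (x - y))⁻¹) • (Q * R * P - Q * R * Q) := by
      rw [mul_assoc K, ← mul_assoc, hQK, add_mul, add_mul, one_mul, hRPQ, smul_mul_assoc,
        smul_mul_assoc, mul_assoc Q, hRPQ, mul_smul_comm, mul_sub Q, ← mul_assoc, ← mul_assoc,
        smul_smul]
    have e4 : Q * (P * R * K) * Q = (c * (x - y))⁻¹ • (P * R - Q * R) +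
        (c * y * (c * (x - y))⁻¹) • (P * R * Q - Q * R * Q) := by
      rw [mul_assoc, mul_assoc (P * R), hKQ, mul_assoc P, ← mul_assoc, hQP]
      simp only [mul_add, mul_one, sub_mul, smul_mul_assoc, mul_assoc, mul_smul_comm]
      module
    rw [e1, e2, e3, e4] at h1
    linear_combination (norm := skip) h1
    match_scalars <;> field_simp <;> ring
  have hRRQ : R * R * Q = w • (R * Q) + Q := by
    rw [hR, add_mul, one_mul, smul_mul_assoc]
  have hQRR : Q * R * R = w • (Q * R) + Q := by
    rw [mul_assoc, hR, mul_add, mul_one, mul_smul_comm]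
  simp only [mul_add, add_mul, mul_sub, sub_mul, smul_mul_assoc, mul_smul_comm, mul_one, one_mul,
    ← mul_assoc, smul_sub, smul_add, smul_smul, hRPQ, hRRQ, hQRR, hPQ, hQP]
  linear_combination (norm := skip) ((1 - y / x) * (1 - (x * y)⁻¹) * (c * (x - x⁻¹)) *
    (c * (y - y⁻¹))) • hRPRQ
  match_scalars <;> field_simp <;> ring

theorem horner_sum_mul_sub {F T : Type*} [CommRing F] [Ring T] [Algebra F T] {A φ : ℕ → F} {s : F}
    (K : T) (h0 : φ 0 = 1) (hφ : ∀ i, φ (i + 1) = φ i * s - A i) (m : ℕ) :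
    (∑ i ∈ Finset.range (m + 1), φ i • K ^ (m - i)) * (K - s • 1) =
      K ^ (m + 1) - ∑ i ∈ Finset.range (m + 1), A i • K ^ (m - i) - φ (m + 1) • 1 := by
  induction m with
  | zero => simp [h0, hφ, sub_smul]
  | succ m ih =>
    have shift (f : ℕ → F) : ∑ i ∈ Finset.range (m + 1), f i • K ^ (m + 1 - i) =
        (∑ i ∈ Finset.range (m + 1), f i • K ^ (m - i)) * K := by
      rw [Finset.sum_mul]
      refine Finset.sum_congr rfl fun i hi => ?_
      rw [smul_mul_assoc, ← pow_succ, Nat.sub_add_comm (Finset.mem_range_succ_iff.mp hi)]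
    have comm : K * (K - s • 1) = (K - s • 1) * K := by
      simp [mul_sub, sub_mul]
    rw [Finset.sum_range_succ, Finset.sum_range_succ (fun i => A i • K ^ (m + 1 - i)), shift, shift,
      add_mul, mul_assoc, comm, ← mul_assoc, ih, hφ (m + 1), pow_succ K (m + 1)]
    simp only [Nat.sub_self, pow_zero, sub_mul, smul_mul_assoc, mul_sub, one_mul, mul_smul_comm,
      mul_one]
    module

theorem commute_horner_sum {F T : Type*} [CommRing F] [Ring T] [Algebra F T] (φ : ℕ → F) (s : F)
    (K : T) (m : ℕ) :
    Commute (∑ i ∈ Finset.range (m + 1), φ i • K ^ (m - i)) (K - s • 1) := by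
  refine Commute.sum_left _ _ _ fun i _ => Commute.smul_left ?_ _
  exact ((Commute.refl K).pow_left _).sub_right ((Commute.one_right _).smul_right _)

theorem pPoly_comp_eq_neg_phiP {F : Type} [Field F] (n : ℕ) (A : ℕ → F) (ξ : F) :
    (pPoly F n A).comp (Polynomial.C ξ * Polynomial.X) = -phiP F A ξ (n + 1) := by
  have h := horner_sum_mul_sub (A := fun i => Polynomial.C (A i)) (φ := phiP F A ξ)
    (s := Polynomial.C ξ * Polynomial.X) (Polynomial.C ξ * Polynomial.X) rfl (fun _ => rfl) n
  rw [smul_eq_mul, mul_one, sub_self, mul_zero] at h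
  simp only [smul_eq_mul, mul_one] at h
  simp only [pPoly, Polynomial.add_comp, Polynomial.neg_comp, Polynomial.X_pow_comp,
    Polynomial.sum_comp, Polynomial.mul_comp, Polynomial.C_comp]
  linear_combination h

theorem psiRat_eq {F : Type} [Field F] {n : ℕ} (A : ℕ → F) {ξ : F} (hξ : ξ ≠ 0) :
    psiRat n A ξ (A n / ξ) = -algebraMap (Polynomial F) (RatFunc F) (phiP F A ξ (n + 1)) /
      (RatFunc.C ξ * (RatFunc.X - RatFunc.X⁻¹)) := by
  have h : Polynomial.C ξ * (- Polynomial.C (ξ ^ n) * Polynomial.X ^ (n + 1) +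
        ∑ i ∈ Finset.range n,
          Polynomial.C (A i * ξ ^ (n - 1 - i)) * Polynomial.X ^ (n - i) +
        Polynomial.C (A n / ξ)) = -phiP F A ξ (n + 1) := by
    rw [← pPoly_comp_eq_neg_phiP]
    simp only [pPoly, Polynomial.add_comp, Polynomial.neg_comp, Polynomial.X_pow_comp,
      Polynomial.sum_comp, Polynomial.mul_comp, Polynomial.C_comp]
    rw [Finset.sum_range_succ, mul_add, ← Polynomial.C_mul, mul_div_cancel₀ _ hξ, mul_add,
      Finset.mul_sum, Nat.sub_self, pow_zero, mul_one, ← add_assoc]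
    congr 2
    · rw [Polynomial.C_pow]; ring
    · refine Finset.sum_congr rfl fun i hi => ?_
      obtain ⟨j, rfl⟩ := Nat.exists_eq_add_of_lt (Finset.mem_range.mp hi)
      rw [show i + j + 1 - 1 - i = j by omega, show i + j + 1 - i = j + 1 by omega, mul_pow,
        Polynomial.C_mul, Polynomial.C_pow]
      ring
  have hC : RatFunc.C ξ ≠ 0 := (map_ne_zero _).mpr hξ
  rw [psiRat, ← mul_div_mul_left _ _ hC, ← map_neg (algebraMap (Polynomial F) (RatFunc F)), ← h, map_mul, RatFunc.algebraMap_C]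

theorem ratFunc_X_sub_inv_ne_zero {F : Type} [Field F] :
    (RatFunc.X - RatFunc.X⁻¹ : RatFunc F) ≠ 0 := by
  have hX : (RatFunc.X : RatFunc F) ≠ 0 := RatFunc.X_ne_zero
  intro h
  have h1 : (RatFunc.X : RatFunc F) ^ 2 = 1 := by
    field_simp at h
    linear_combination h
  have h2 : (Polynomial.X : Polynomial F) ^ 2 = 1 := by
    apply RatFunc.algebraMap_injective F
    simpa using h1
  have := congrArg Polynomial.natDegree h2
  simp at this

theorem phiT_eq_tmul {F S : Type} [Field F] [Ring S] [Algebra F S] (ξ : F) (A : ℕ → F) (i : ℕ) :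
    phiT F F (B := S) ξ A i = algebraMap (Polynomial F) (RatFunc F) (phiP F A ξ i) ⊗ₜ 1 := by
  have scalar (f : RatFunc F) (a : F) : f ⊗ₜ[F] algebraMap F S a = (RatFunc.C a * f) ⊗ₜ 1 := by
    rw [Algebra.algebraMap_eq_smul_one, ← TensorProduct.smul_tmul, RatFunc.smul_eq_C_mul]
  induction i with
  | zero => simp [phiT, phiP, Algebra.TensorProduct.one_def]
  | succ i ih =>
    rw [phiT, ih, scalar, scalar, phiP, Algebra.TensorProduct.tmul_mul_tmul, one_mul, mul_one,
      ← TensorProduct.sub_tmul]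
    simp

/-- The principal baxterized element attached to an element `K` of an algebra. -/
def principalElt {F S : Type} [Field F] [Ring S] [Algebra F S] (K : S) (n : ℕ) (A : ℕ → F)
    (ξ ζ : F) : RatFunc F ⊗[F] S :=
  (∑ i ∈ Finset.range n,
      phiT F F (B := S) ξ A i * ((1 : RatFunc F) ⊗ₜ[F] K ^ (n - i))) +
    ((RatFunc.X - RatFunc.X⁻¹)⁻¹ : RatFunc F) •
      ((1 : RatFunc F) ⊗ₜ[F] algebraMap F S ζ -
        (RatFunc.X⁻¹ : RatFunc F) • phiT F F (B := S) ξ A n)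

theorem KxMain_eq_principalElt {F : Type} [Field F] (w : F) (n : ℕ) (A : ℕ → F) (ξ ζ : F) :
    KxMain F F w n A ξ ζ = principalElt (Kp F w n A) n A ξ ζ := rfl

/-- The Horner sum `∑ φ_i(ξ,x) K^(n-i)`, equal to `p(ξx)/(K-ξx)` when `p(K) = 0`. -/
def hornerElt {F S : Type} [Field F] [Ring S] [Algebra F S] (K : S) (n : ℕ) (A : ℕ → F)
    (ξ : F) : RatFunc F ⊗[F] S :=
  ∑ i ∈ Finset.range (n + 1),
    algebraMap (Polynomial F) (RatFunc F) (phiP F A ξ i) • ((1 : RatFunc F) ⊗ₜ[F] K) ^ (n - i)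

theorem principalElt_eq {F S : Type} [Field F] [Ring S] [Algebra F S] (K : S) {n : ℕ} (A : ℕ → F)
    {ξ : F} (hξ : ξ ≠ 0) :
    principalElt K n A ξ (A n / ξ) =
      hornerElt K n A ξ + psiRat n A ξ (A n / ξ) • 1 := by
  have hX : (RatFunc.X : RatFunc F) ≠ 0 := RatFunc.X_ne_zero
  have hX' := ratFunc_X_sub_inv_ne_zero (F := F)
  have hC : RatFunc.C ξ ≠ 0 := (map_ne_zero _).mpr hξ
  have hφ (i : ℕ) : phiT F F (B := S) ξ A i =
      algebraMap (Polynomial F) (RatFunc F) (phiP F A ξ i) • 1 := by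
    rw [phiT_eq_tmul, Algebra.TensorProduct.one_def, TensorProduct.smul_tmul', smul_eq_mul, mul_one]
  have hζ : (1 : RatFunc F) ⊗ₜ[F] algebraMap F S (A n / ξ) =
      (RatFunc.C (A n) / RatFunc.C ξ) • (1 : RatFunc F ⊗[F] S) := by
    rw [Algebra.algebraMap_eq_smul_one, ← TensorProduct.smul_tmul, RatFunc.smul_eq_C_mul, map_div₀,
      Algebra.TensorProduct.one_def, TensorProduct.smul_tmul', smul_eq_mul]
  have hΦ : algebraMap (Polynomial F) (RatFunc F) (phiP F A ξ (n + 1)) =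
      algebraMap (Polynomial F) (RatFunc F) (phiP F A ξ n) * (RatFunc.C ξ * RatFunc.X) -
        RatFunc.C (A n) := by
    simp [phiP]
  rw [principalElt, hornerElt, Finset.sum_range_succ, psiRat_eq A hξ, hΦ, hζ]
  simp only [hφ, smul_mul_assoc, one_mul, Algebra.TensorProduct.tmul_pow, one_pow, Nat.sub_self,
    pow_zero]
  rw [add_assoc]
  congr 1
  rw [smul_smul, ← sub_smul, smul_smul, ← add_smul]
  congr 1
  have hX2 : (RatFunc.X ^ 2 - 1 : RatFunc F) ≠ 0 := by
    have h : (RatFunc.X ^ 2 - 1 : RatFunc F) = RatFunc.X * (RatFunc.X - RatFunc.X⁻¹) := by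
      field_simp
    rw [h]
    exact mul_ne_zero hX hX'
  field_simp
  ring

theorem hornerElt_mul {F S : Type} [Field F] [Ring S] [Algebra F S] {K : S} {n : ℕ} {A : ℕ → F}
    (hK : -K ^ (n + 1) + ∑ i ∈ Finset.range (n + 1), A i • K ^ (n - i) = 0) (ξ : F) :
    hornerElt K n A ξ * ((1 : RatFunc F) ⊗ₜ[F] K - (RatFunc.C ξ * RatFunc.X) • 1) =
      (-algebraMap (Polynomial F) (RatFunc F) (phiP F A ξ (n + 1))) • 1 := by
  rw [hornerElt, horner_sum_mul_sub (A := fun i => RatFunc.C (A i)) (F := RatFunc F)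
    (φ := fun i => algebraMap (Polynomial F) (RatFunc F) (phiP F A ξ i))]
  · have h := congrArg (fun t => (1 : RatFunc F) ⊗ₜ[F] t) hK
    simp only [TensorProduct.tmul_add, TensorProduct.tmul_neg, TensorProduct.tmul_sum,
      TensorProduct.tmul_zero] at h
    have hs (i : ℕ) : (1 : RatFunc F) ⊗ₜ[F] (A i • K ^ (n - i)) =
        RatFunc.C (A i) • ((1 : RatFunc F) ⊗ₜ[F] K) ^ (n - i) := by
      rw [← TensorProduct.smul_tmul, RatFunc.smul_eq_C_mul, Algebra.TensorProduct.tmul_pow, one_pow,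
        TensorProduct.smul_tmul', smul_eq_mul]
    simp only [hs] at h
    rw [Algebra.TensorProduct.tmul_pow, one_pow, neg_smul, neg_add_eq_zero.mp h, sub_self,
      zero_sub]
  · simp [phiP]
  · intro i
    simp [phiP]

theorem phiP_succ_eval {F : Type} [Field F] (n : ℕ) (A : ℕ → F) (ξ a : F) :
    (phiP F A ξ (n + 1)).eval a = -(pPoly F n A).eval (ξ * a) := by
  rw [← neg_neg (phiP F A ξ (n + 1)), ← pPoly_comp_eq_neg_phiP, Polynomial.eval_neg,
    Polynomial.eval_comp]
  simp

theorem phiP_succ_ne_zero {F : Type} [Field F] {n : ℕ} {A : ℕ → F} {ξ a : F}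
    (hp : (pPoly F n A).eval (ξ * a) ≠ 0) : phiP F A ξ (n + 1) ≠ 0 := by
  intro h
  have := phiP_succ_eval n A ξ a
  rw [h, Polynomial.eval_zero, eq_comm, neg_eq_zero] at this
  exact hp this

/-- The inverse `(K-ξx)⁻¹ = p(ξx)⁻¹ ∑ φ_i(ξ,x) K^(n-i)`. -/
def resolventElt {F S : Type} [Field F] [Ring S] [Algebra F S] (K : S) (n : ℕ) (A : ℕ → F)
    (ξ : F) : RatFunc F ⊗[F] S :=
  (-algebraMap (Polynomial F) (RatFunc F) (phiP F A ξ (n + 1)))⁻¹ • hornerElt K n A ξ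

theorem resolventElt_mul {F S : Type} [Field F] [Ring S] [Algebra F S] {K : S} {n : ℕ} {A : ℕ → F}
    (hK : -K ^ (n + 1) + ∑ i ∈ Finset.range (n + 1), A i • K ^ (n - i) = 0) {ξ : F}
    (hΦ : phiP F A ξ (n + 1) ≠ 0) :
    resolventElt K n A ξ * ((1 : RatFunc F) ⊗ₜ[F] K - (RatFunc.C ξ * RatFunc.X) • 1) = 1 := by
  rw [resolventElt, smul_mul_assoc, hornerElt_mul hK, smul_smul, inv_mul_cancel₀, one_smul]
  simpa using hΦ

theorem mul_resolventElt {F S : Type} [Field F] [Ring S] [Algebra F S] {K : S} {n : ℕ} {A : ℕ → F}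
    (hK : -K ^ (n + 1) + ∑ i ∈ Finset.range (n + 1), A i • K ^ (n - i) = 0) {ξ : F}
    (hΦ : phiP F A ξ (n + 1) ≠ 0) :
    ((1 : RatFunc F) ⊗ₜ[F] K - (RatFunc.C ξ * RatFunc.X) • 1) * resolventElt K n A ξ = 1 := by
  refine Eq.trans ?_ (resolventElt_mul hK hΦ)
  have h : Commute (hornerElt K n A ξ)
      ((1 : RatFunc F) ⊗ₜ[F] K - (RatFunc.C ξ * RatFunc.X) • 1) := commute_horner_sum _ _ _ _
  rw [resolventElt, smul_mul_assoc, mul_smul_comm, h.eq]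

theorem smul_principalElt_eq_add_hornerElt {F S : Type} [Field F] [Ring S] [Algebra F S] (K : S)
    {n : ℕ} {A : ℕ → F} {ξ : F} (hξ : ξ ≠ 0) (hΦ : phiP F A ξ (n + 1) ≠ 0) :
    (psiRat n A ξ (A n / ξ))⁻¹ • principalElt K n A ξ (A n / ξ) =
      1 + (psiRat n A ξ (A n / ξ))⁻¹ • hornerElt K n A ξ := by
  have hψ : psiRat n A ξ (A n / ξ) ≠ 0 := by
    rw [psiRat_eq A hξ]
    refine div_ne_zero (by simpa using hΦ) (mul_ne_zero ?_ ratFunc_X_sub_inv_ne_zero)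
    exact (map_ne_zero _).mpr hξ
  rw [principalElt_eq K A hξ, smul_add, smul_smul, inv_mul_cancel₀ hψ, one_smul, add_comm]

theorem smul_principalElt_eq_add_resolventElt {F S : Type} [Field F] [Ring S] [Algebra F S] (K : S)
    {n : ℕ} {A : ℕ → F} {ξ : F} (hξ : ξ ≠ 0) (hΦ : phiP F A ξ (n + 1) ≠ 0) :
    (psiRat n A ξ (A n / ξ))⁻¹ • principalElt K n A ξ (A n / ξ) =
      1 + (RatFunc.C ξ * (RatFunc.X - RatFunc.X⁻¹)) • resolventElt K n A ξ := by
  rw [smul_principalElt_eq_add_hornerElt K hξ hΦ, resolventElt, smul_smul, psiRat_eq A hξ, inv_div,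
    div_eq_mul_inv]

theorem emb_X {F : Type} [Field F] (i : Fin 2) :
    emb F i RatFunc.X = algebraMap (P2 F) (F2 F) (MvPolynomial.X i) := by
  have h : RatFunc.X = algebraMap (Polynomial F) (RatFunc F) Polynomial.X :=
    RatFunc.algebraMap_X.symm
  rw [h, emb, RatFunc.liftAlgHom_apply]
  simp [embP]

theorem iota_smul {F S : Type} [Field F] [Ring S] [Algebra F S] (i : Fin 2) (f : RatFunc F)
    (t : RatFunc F ⊗[F] S) : iota F i (f • t) = emb F i f • iota F i t := by
  induction t using TensorProduct.induction_on with
  | zero => simp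
  | tmul g b => simp [iota, TensorProduct.smul_tmul']
  | add a b ha hb => rw [smul_add, map_add, ha, hb, map_add, smul_add]

theorem iota_one_tmul {F S : Type} [Field F] [Ring S] [Algebra F S] (i : Fin 2) (b : S) :
    iota F i ((1 : RatFunc F) ⊗ₜ[F] b) = (1 : F2 F) ⊗ₜ[F] b := by
  simp [iota]

theorem emb_C {F : Type} [Field F] (i : Fin 2) (a : F) :
    emb F i (RatFunc.C a) = algebraMap F (F2 F) a := by
  rw [← RatFunc.algebraMap_eq_C]; exact (emb F i).commutes a

theorem xvar_ne_zero {F : Type} [Field F] : xvar F ≠ 0 := by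
  simp [xvar]

theorem yvar_ne_zero {F : Type} [Field F] : yvar F ≠ 0 := by
  simp [yvar]

theorem xvar_ne_yvar {F : Type} [Field F] : xvar F ≠ yvar F := by
  intro h
  have := MvPolynomial.X_injective (IsFractionRing.injective (P2 F) (F2 F) h)
  simp at this

theorem isSol_smul_principalElt {F S : Type} [Field F] [Ring S] [Algebra F S] {w : F} {R K : S}
    {n : ℕ} {A : ℕ → F} (hR : R * R = w • R + 1) (hRK : R * K * R * K = K * R * K * R)
    (hK : -K ^ (n + 1) + ∑ i ∈ Finset.range (n + 1), A i • K ^ (n - i) = 0) {ξ : F} (hξ : ξ ≠ 0)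
    (hΦ : phiP F A ξ (n + 1) ≠ 0) :
    IsSol F w R ((psiRat n A ξ (A n / ξ))⁻¹ • principalElt K n A ξ (A n / ξ)) := by
  have hx : emb F 0 RatFunc.X = xvar F := emb_X 0
  have hy : emb F 1 RatFunc.X = yvar F := emb_X 1
  have hl (i : Fin 2) := congrArg (iota F i) (resolventElt_mul hK hΦ)
  have hr (i : Fin 2) := congrArg (iota F i) (mul_resolventElt hK hΦ)
  simp only [map_mul, map_sub, iota_smul, iota_one_tmul, map_one, emb_C] at hl hr
  have hRx (t : F2 F) : RxElt F w R t = (1 : F2 F) ⊗ₜ[F] R -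
      t⁻¹ • ((1 : F2 F) ⊗ₜ[F] R - algebraMap F (F2 F) w • 1) := by
    rw [RxElt, TensorProduct.tmul_sub, Algebra.algebraMap_eq_smul_one, ← TensorProduct.smul_tmul,
      Algebra.smul_def w (1 : F2 F), Algebra.TensorProduct.one_def, TensorProduct.smul_tmul',
      smul_eq_mul]
  rw [smul_principalElt_eq_add_resolventElt K hξ hΦ]
  simp only [IsSol, map_add, map_one, iota_smul, map_mul, map_sub, map_inv₀, emb_C, hRx, hx, hy]
  refine reflection_equation_of_inverses (K := (1 : F2 F) ⊗ₜ[F] K) xvar_ne_zero yvar_ne_zero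
    xvar_ne_yvar ((map_ne_zero _).mpr hξ) ?_ ?_ ?_ ?_ ?_ ?_
  · rw [Algebra.TensorProduct.tmul_mul_tmul, hR, TensorProduct.tmul_add, mul_one,
      ← TensorProduct.smul_tmul, Algebra.smul_def w (1 : F2 F), Algebra.TensorProduct.one_def,
      TensorProduct.smul_tmul', smul_eq_mul]
  · simp only [Algebra.TensorProduct.tmul_mul_tmul, hRK]
  · rw [← hx]; exact hl 0
  · rw [← hx]; exact hr 0
  · rw [← hy]; exact hl 1
  · rw [← hy]; exact hr 1

theorem smul_principalElt_mul_map_eq_one {F S : Type} [Field F] [Ring S] [Algebra F S] {K : S}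
    {n : ℕ} {A : ℕ → F}
    (hK : -K ^ (n + 1) + ∑ i ∈ Finset.range (n + 1), A i • K ^ (n - i) = 0) {ξ : F} (hξ : ξ ≠ 0)
    (hΦ : phiP F A ξ (n + 1) ≠ 0) (σ : RatFunc F →ₐ[F] RatFunc F)
    (hσ : σ RatFunc.X = RatFunc.X⁻¹) :
    ((psiRat n A ξ (A n / ξ))⁻¹ • principalElt K n A ξ (A n / ξ)) *
      Algebra.TensorProduct.map σ (AlgHom.id F S)
        ((psiRat n A ξ (A n / ξ))⁻¹ • principalElt K n A ξ (A n / ξ)) = 1 := by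
  have map_smul' (f : RatFunc F) (t : RatFunc F ⊗[F] S) :
      Algebra.TensorProduct.map σ (AlgHom.id F S) (f • t) =
        σ f • Algebra.TensorProduct.map σ (AlgHom.id F S) t := by
    rw [Algebra.smul_def, map_mul, Algebra.smul_def]
    simp [Algebra.TensorProduct.algebraMap_apply]
  have hC : σ (RatFunc.C ξ) = RatFunc.C ξ := by
    rw [← RatFunc.algebraMap_eq_C]; exact σ.commutes ξ
  have hc : (psiRat n A ξ (A n / ξ))⁻¹ • principalElt K n A ξ (A n / ξ) =
      ((1 : RatFunc F) ⊗ₜ[F] K - (RatFunc.C ξ * RatFunc.X⁻¹) • 1) * resolventElt K n A ξ := by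
    have h := mul_resolventElt hK hΦ
    rw [sub_mul, smul_mul_assoc, one_mul, sub_eq_iff_eq_add] at h
    rw [smul_principalElt_eq_add_resolventElt K hξ hΦ, sub_mul, h, smul_mul_assoc, one_mul, mul_sub,
      sub_smul]
    abel
  have hσP := congrArg (Algebra.TensorProduct.map σ (AlgHom.id F S)) (mul_resolventElt hK hΦ)
  rw [hc]
  simp only [map_mul, map_sub, map_smul', map_one, hC, hσ, map_inv₀, inv_inv,
    Algebra.TensorProduct.map_tmul, AlgHom.id_apply] at hσP ⊢
  rw [mul_assoc, ← mul_assoc (resolventElt K n A ξ), resolventElt_mul hK hΦ, one_mul, hσP]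

theorem regularAtWithValue_one_add_sum {F S : Type} [Field F] [Ring S] [Algebra F S] {a : F}
    {m : ℕ} (N : Fin m → Polynomial F) {M : Polynomial F} (h : Fin m → S) (hM : M.eval a ≠ 0)
    (hN : ∀ i, (N i).eval a = 0) :
    RegularAtWithValue (1 + ∑ i, (algebraMap (Polynomial F) (RatFunc F) (N i) /
      algebraMap (Polynomial F) (RatFunc F) M) ⊗ₜ[F] h i) a 1 := by
  have hM0 : M ≠ 0 := by rintro rfl; simp at hM
  obtain ⟨g, hg⟩ : ∃ g : Fin m → RatFunc F, ∀ i, g i =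
    algebraMap (Polynomial F) (RatFunc F) (N i) / algebraMap (Polynomial F) (RatFunc F) M :=
    ⟨_, fun _ => rfl⟩
  have hden (i : Fin m) : (g i).denom.eval a ≠ 0 := fun h0 =>
    hM (Polynomial.eval_eq_zero_of_dvd_of_eval_eq_zero (hg i ▸ RatFunc.denom_div_dvd (N i) M) h0)
  have hnum (i : Fin m) : (g i).num.eval a = 0 := by
    have h := congrArg (Polynomial.eval a) ((RatFunc.num_mul_eq_mul_denom_iff hM0).mpr (hg i))
    rw [Polynomial.eval_mul, Polynomial.eval_mul, hN, zero_mul] at h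
    exact (mul_eq_zero.mp h).resolve_right hM
  simp only [← hg]
  refine ⟨m + 1, Fin.cons 1 g, Fin.cons 1 h, ?_, ?_, ?_⟩
  · simp [Fin.sum_univ_succ, Algebra.TensorProduct.one_def]
  · intro i
    refine Fin.cases ?_ (fun j => ?_) i
    · simp
    · simpa using hden j
  · simp [Fin.sum_univ_succ, hnum]

theorem regularAtWithValue_smul_principalElt {F S : Type} [Field F] [Ring S] [Algebra F S] (K : S)
    {n : ℕ} {A : ℕ → F} {ξ a : F} (hξ : ξ ≠ 0) (ha : a ^ 2 = 1)
    (hp : (pPoly F n A).eval (ξ * a) ≠ 0) :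
    RegularAtWithValue ((psiRat n A ξ (A n / ξ))⁻¹ • principalElt K n A ξ (A n / ξ)) a 1 := by
  have hev : (phiP F A ξ (n + 1)).eval a ≠ 0 := by simpa [phiP_succ_eval] using hp
  have hΦ := phiP_succ_ne_zero hp
  have hX : (RatFunc.X : RatFunc F) ≠ 0 := RatFunc.X_ne_zero
  have hΦ' : algebraMap (Polynomial F) (RatFunc F) (phiP F A ξ (n + 1)) ≠ 0 := by simpa using hΦ
  have ha0 : a ≠ 0 := by rintro rfl; simp at ha
  convert regularAtWithValue_one_add_sum (a := a)
    (fun i : Fin (n + 1) => -Polynomial.C ξ * (Polynomial.X ^ 2 - 1) * phiP F A ξ i)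
    (M := Polynomial.X * phiP F A ξ (n + 1)) (fun i => K ^ (n - i)) ?_ ?_ using 1
  · rw [smul_principalElt_eq_add_hornerElt K hξ hΦ, hornerElt, Finset.smul_sum,
      Finset.sum_range]
    congr 1
    refine Finset.sum_congr rfl fun i _ => ?_
    rw [smul_smul, Algebra.TensorProduct.tmul_pow, one_pow, TensorProduct.smul_tmul', smul_eq_mul,
      mul_one, psiRat_eq A hξ]
    congr 1
    simp only [map_mul, map_sub, map_neg, map_pow, map_one, RatFunc.algebraMap_X,
      RatFunc.algebraMap_C]
    field_simp
  · simpa [ha0] using hev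
  · intro i
    simp [ha]

theorem Rp_mul_Rp {F : Type} [Field F] (w : F) (n : ℕ) (A : ℕ → F) :
    Rp F w n A * Rp F w n A = w • Rp F w n A + 1 := by
  have h : Rg F w * Rg F w = w • Rg F w + 1 := by
    have := RingQuot.mkAlgHom_rel F (HRel.hecke (z := F) (ω := w))
    simp only [map_mul, map_add, map_smul, map_one] at this
    exact this
  have := congrArg (RingQuot.mkAlgHom F (CRel F w n A)) h
  simp only [map_mul, map_add, map_smul, map_one] at this
  exact this

theorem Rp_Kp_reflection {F : Type} [Field F] (w : F) (n : ℕ) (A : ℕ → F) :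
    Rp F w n A * Kp F w n A * Rp F w n A * Kp F w n A =
      Kp F w n A * Rp F w n A * Kp F w n A * Rp F w n A := by
  have h : Rg F w * Kg F w * Rg F w * Kg F w = Kg F w * Rg F w * Kg F w * Rg F w := by
    have := RingQuot.mkAlgHom_rel F (HRel.re (z := F) (ω := w))
    simp only [map_mul] at this
    exact this
  have := congrArg (RingQuot.mkAlgHom F (CRel F w n A)) h
  simp only [map_mul] at this
  exact this

theorem pPoly_Kp_eq_zero {F : Type} [CommRing F] (w : F) (n : ℕ) (A : ℕ → F) :
    -Kp F w n A ^ (n + 1) + ∑ i ∈ Finset.range (n + 1), A i • Kp F w n A ^ (n - i) = 0 := by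
  have := RingQuot.mkAlgHom_rel F (CRel.mk (z := F) (ω := w) (n := n) (A := A))
  simp only [pKelt, map_add, map_neg, map_pow, map_sum, map_smul, map_zero] at this
  exact this

/-- Suppose 𝔷 is a field, ξ ≠ 0, ζ = p(0)/ξ, and p(±ξ) ≠ 0. Then
K̂(x) = K_p(ξ,ζ,x)/ψ(ξ,ζ,x) is a unitary and regular solution of the reflection equation
with spectral parameter: K̂(x)K̂(x⁻¹) = 1 and K̂(±1) = 1. -/
theorem unitary_regular_solution [CharZero k] {zf : Type} [Field zf] [Algebra k zf]
    (q : k) (hq0 : q ≠ 0) (hq1 : q ≠ 1) (hq1' : q ≠ -1)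
    (ωf : zf) (hω : ωf = algebraMap k zf (q - q⁻¹))
    (n : ℕ) (hn : 1 ≤ n) (A : ℕ → zf) (xi : zf) (hxi : xi ≠ 0)
    (hp1 : Polynomial.eval xi (pPoly zf n A) ≠ 0)
    (hp2 : Polynomial.eval (-xi) (pPoly zf n A) ≠ 0) :
    IsSol zf ωf (Rp zf ωf n A)
        ((psiRat n A xi (A n / xi))⁻¹ • KxMain zf zf ωf n A xi (A n / xi)) ∧
      (∀ σ : RatFunc zf →ₐ[zf] RatFunc zf, σ RatFunc.X = RatFunc.X⁻¹ →
        ((psiRat n A xi (A n / xi))⁻¹ • KxMain zf zf ωf n A xi (A n / xi)) *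
            Algebra.TensorProduct.map σ (AlgHom.id zf (Hp zf ωf n A))
              ((psiRat n A xi (A n / xi))⁻¹ • KxMain zf zf ωf n A xi (A n / xi)) = 1) ∧
      RegularAtWithValue
        ((psiRat n A xi (A n / xi))⁻¹ • KxMain zf zf ωf n A xi (A n / xi)) 1 1 ∧
      RegularAtWithValue
        ((psiRat n A xi (A n / xi))⁻¹ • KxMain zf zf ωf n A xi (A n / xi)) (-1) 1 := by
  have hp1' : Polynomial.eval (xi * 1) (pPoly zf n A) ≠ 0 := by rwa [mul_one]
  have hp2' : Polynomial.eval (xi * -1) (pPoly zf n A) ≠ 0 := by rwa [mul_neg_one]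
  have hΦ := phiP_succ_ne_zero hp1'
  have hK := pPoly_Kp_eq_zero ωf n A
  rw [KxMain_eq_principalElt]
  exact ⟨isSol_smul_principalElt (Rp_mul_Rp ωf n A) (Rp_Kp_reflection ωf n A) hK hxi hΦ,
    smul_principalElt_mul_map_eq_one hK hxi hΦ,
    regularAtWithValue_smul_principalElt _ hxi (one_pow 2) hp1',
    regularAtWithValue_smul_principalElt _ hxi neg_one_sq hp2'⟩

end Baxterization
end
end
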